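/- arXiv:2308.02775 — 5 statements merged into one kernel-verified Lean document; each statement's English description precedes it below -/
import Mathlib

section
/- Let p be a prime and let (G, {G_(i)}) be a p-filtered group of order p^n. Then for every 1 ≤ i ≤ n one has rank(G/G_(i)) = rank(G/G_(i-1)) + 1 if i ∈ Σ_G, and rank(G/G_(i)) = rank(G/G_(i-1)) if i ∉ Σ_G. -/
/-!
STATEMENT 0 (Proposition 2.2 of the paper):
Let (G, {G_(i)}) be a p-filtered group of order p^n, i.e. G is a group of order p^n with a
composition series {1} = G_(n) < ... < G_(1) < G_(0) = G of normal subgroups of G with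
|G_(i)| = p^{n-i}.  Let Σ_G be the set of 1 ≤ i ≤ n such that the extension of G/G_(i-1) by
G_(i-1)/G_(i) given by G/G_(i) is split.  With rank(H) denoting the rank of H/Φ(H) (Φ the
Frattini subgroup), one has, for 1 ≤ i ≤ n:
rank(G/G_(i)) = rank(G/G_(i-1)) + 1 if i ∈ Σ_G, and rank(G/G_(i)) = rank(G/G_(i-1)) otherwise.
-/

/-- `i ∈ Σ_G`: the extension of `G/G_(i-1)` by `G_(i-1)/G_(i)` given by the quotient
`G/G_(i)` is split, i.e. the image of `G_(i-1)` in `G/G_(i)` admits a complement. -/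
def splitAt {G : Type*} [Group G] (Gser : ℕ → Subgroup G) [∀ j, (Gser j).Normal]
    (i : ℕ) : Prop :=
  ∃ H : Subgroup (G ⧸ Gser i),
    ((Gser (i - 1)).map (QuotientGroup.mk' (Gser i))).IsComplement' H

/-- The rank of a finite `p`-group: the rank of the elementary abelian group `H/Φ(H)`,
i.e. the minimal number of generators of `H/Φ(H)`. -/
noncomputable def pRank (H : Type*) [Group H] [Finite H] : ℕ :=
  Group.rank (H ⧸ frattini H)

namespace FiltAux

lemma rank_spec (Q : Type*) [Group Q] [Finite Q] :
    ∃ S : Finset Q, S.card = Group.rank Q ∧ Subgroup.closure (S : Set Q) = ⊤ :=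
  Group.rank_spec Q

lemma sup_frattini {Q : Type*} [Group Q] [Finite Q] {K : Subgroup Q}
    (h : K ⊔ frattini Q = ⊤) : K = ⊤ :=
  frattini_nongenerating h

/-- lifting finite sets along surjections -/
lemma lift_gen {Q R : Type*} [Group Q] [Group R] (f : Q →* R) (hf : Function.Surjective f)
    (S : Finset R) : ∃ L : Finset Q, L.card ≤ S.card ∧
      (Subgroup.closure (L : Set Q)).map f = Subgroup.closure (S : Set R) := by
  classical
  refine ⟨S.image (Function.surjInv hf), Finset.card_image_le, ?_⟩
  rw [MonoidHom.map_closure, Finset.coe_image, ← Set.image_comp]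
  congr 1
  convert Set.image_id _
  ext x
  simp [Function.surjInv_eq hf]

lemma rank_eq {Q R : Type*} [Group Q] [Group R] [Finite Q] [Finite R] (f : Q →* R)
    (hf : Function.Surjective f) (hk : f.ker ≤ frattini Q) : Group.rank Q = Group.rank R := by
  apply le_antisymm
  · obtain ⟨S, hS, hS'⟩ := rank_spec R
    obtain ⟨L, hL, hL'⟩ := lift_gen f hf S
    rw [← hS]
    refine le_trans (Group.rank_le (S := L) ?_) hL
    apply sup_frattini
    rw [eq_top_iff]
    calc ⊤ = Subgroup.comap f (Subgroup.map f (Subgroup.closure (L : Set Q))) := by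
            rw [hL', hS', Subgroup.comap_top]
      _ = Subgroup.closure (L : Set Q) ⊔ f.ker := Subgroup.comap_map_eq _ _
      _ ≤ _ := sup_le_sup_left hk _
  · exact Group.rank_le_of_surjective f hf

lemma pRank_eq (Q : Type*) [Group Q] [Finite Q] : pRank Q = Group.rank Q :=
  (rank_eq (QuotientGroup.mk' (frattini Q)) (QuotientGroup.mk'_surjective _)
    (by rw [QuotientGroup.ker_mk'])).symm

lemma coatom_index {Q : Type*} [Group Q] [Finite Q] {p k : ℕ} (hp : p.Prime)
    (hQ : Nat.card Q = p ^ k) {M : Subgroup Q} (hM : IsCoatom M) : M.index = p := by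
  have := Fact.mk hp
  obtain ⟨m, hmk, hm⟩ := (Nat.dvd_prime_pow hp).1 (hQ ▸ M.card_subgroup_dvd_card)
  have hlt : m < k := by
    refine lt_of_le_of_ne hmk fun h => hM.1 ?_
    apply Subgroup.eq_top_of_card_eq
    rw [hm, hQ, h]
  obtain ⟨K, hK, hMK⟩ := Sylow.exists_subgroup_card_pow_succ (n := m)
    (hQ ▸ pow_dvd_pow p hlt) hm
  have hne : M ≠ K := by
    rintro rfl
    rw [hm] at hK
    exact absurd (Nat.pow_right_injective hp.two_le hK) (by simp)
  have hKt : K = ⊤ := hM.2 K (lt_of_le_of_ne hMK hne)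
  have h1 := M.card_mul_index
  rw [hKt, Subgroup.card_top] at hK
  rw [hK, hm, pow_succ] at h1
  exact Nat.eq_of_mul_eq_mul_left (pow_pos hp.pos m) h1

lemma coatom_normal {Q : Type*} [Group Q] [Finite Q] {p k : ℕ} (hp : p.Prime)
    (hQ : Nat.card Q = p ^ k) {M : Subgroup Q} (hM : IsCoatom M) : M.Normal := by
  have := Fact.mk hp
  have := (IsPGroup.of_card hQ).isNilpotent
  exact (Subgroup.NormalizerCondition.normal_of_coatom _ Group.normalizerCondition_of_isNilpotent hM)

lemma comm_pow {Q : Type*} [Group Q] [Finite Q] {p k : ℕ} (hp : p.Prime)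
    (hQ : Nat.card Q = p ^ k) (x y : Q) : x ^ p ∈ frattini Q ∧
      (x * y)⁻¹ * (y * x) ∈ frattini Q := by
  have := Fact.mk hp
  have key : ∀ M : Subgroup Q, IsCoatom M → x ^ p ∈ M ∧ (x * y)⁻¹ * (y * x) ∈ M := by
    intro M hM
    have := coatom_normal hp hQ hM
    have hc : Nat.card (Q ⧸ M) = p := coatom_index hp hQ hM
    have : IsCyclic (Q ⧸ M) := isCyclic_of_prime_card hc
    constructor
    · rw [← QuotientGroup.eq_one_iff, QuotientGroup.mk_pow, ← hc, pow_card_eq_one']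
    · rw [← QuotientGroup.eq, QuotientGroup.mk_mul, QuotientGroup.mk_mul]
      exact (IsCyclic.isMulCommutative (α := Q ⧸ M)).is_comm.comm _ _
  simp only [frattini, Order.radical, Subgroup.mem_iInf]
  exact ⟨fun M hM => (key M hM).1, fun M hM => (key M hM).2⟩

/-- exchange property in elementary abelian groups -/
lemma exchange {A : Type*} [CommGroup A] {p : ℕ} (hp : p.Prime) (hexp : ∀ a : A, a ^ p = 1)
    (z : A) (hz : z ≠ 1) (S : Finset A) (hS : z ∈ Subgroup.closure (S : Set A)) :
    ∃ T : Finset A, T.card + 1 ≤ S.card ∧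
      Subgroup.closure (S : Set A) ≤ Subgroup.closure (T : Set A) ⊔ Subgroup.zpowers z := by
  classical
  induction S using Finset.induction_on with
  | empty =>
    rw [Finset.coe_empty, Subgroup.closure_empty, Subgroup.mem_bot] at hS
    exact absurd hS hz
  | insert s S hs ih =>
    have hins : ∀ U : Finset A, Subgroup.closure ((insert s U : Finset A) : Set A) =
        Subgroup.zpowers s ⊔ Subgroup.closure (U : Set A) := by
      intro U
      rw [Finset.coe_insert, Set.insert_eq, Subgroup.closure_union, Subgroup.zpowers_eq_closure]
    by_cases hzS : z ∈ Subgroup.closure (S : Set A)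
    · obtain ⟨T, hT, hT'⟩ := ih hzS
      refine ⟨insert s T, ?_, ?_⟩
      · rw [Finset.card_insert_of_notMem hs]
        have := Finset.card_insert_le s T
        omega
      · rw [hins, hins, sup_assoc]
        exact sup_le_sup_left hT' _
    · refine ⟨S, by rw [Finset.card_insert_of_notMem hs], ?_⟩
      rw [hins] at hS ⊢
      refine sup_le ?_ le_sup_left
      rw [Subgroup.zpowers_le]
      obtain ⟨y, hy, t, ht, hyt⟩ := Subgroup.mem_sup.1 hS
      obtain ⟨k, rfl⟩ := Subgroup.mem_zpowers_iff.1 hy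
      have hexp' : s ^ (p : ℤ) = 1 := by rw [zpow_natCast, hexp]
      have hpk : ¬ (p : ℤ) ∣ k := by
        rintro ⟨c, rfl⟩
        rw [zpow_mul, hexp', one_zpow, one_mul] at hyt
        exact hzS (hyt ▸ ht)
      have hcop : IsCoprime (p : ℤ) k :=
        (Prime.coprime_iff_not_dvd (Nat.prime_iff_prime_int.1 hp)).2 hpk
      obtain ⟨a, b, hab⟩ := hcop
      have hsk : s ^ k ∈ Subgroup.closure (S : Set A) ⊔ Subgroup.zpowers z := by
        have : s ^ k = t⁻¹ * z := by rw [← hyt, mul_comm (s ^ k), inv_mul_cancel_left]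
        rw [this]
        exact mul_mem (inv_mem (Subgroup.mem_sup_left ht))
          (Subgroup.mem_sup_right (Subgroup.mem_zpowers z))
      have : s = (s ^ k) ^ b := by
        calc s = s ^ (a * p + b * k) := by rw [hab, zpow_one]
          _ = (s ^ k) ^ b := by
            rw [zpow_add, mul_comm a, zpow_mul, hexp', one_zpow, one_mul, mul_comm b, zpow_mul]
      rw [this]
      exact zpow_mem hsk b

lemma eq_zpowers {Q : Type*} [Group Q] [Finite Q] {p : ℕ} (hp : p.Prime) {N K : Subgroup Q}
    (hN : Nat.card N = p) (h : ¬ N ≤ K) : Disjoint N K := by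
  rw [disjoint_iff]
  rcases (Nat.dvd_prime hp).1 (hN ▸ Subgroup.card_dvd_of_le (inf_le_left : N ⊓ K ≤ N)) with h1 | h1
  · exact Subgroup.card_eq_one.1 h1
  · exact absurd (inf_eq_left.1 (Subgroup.eq_of_le_of_card_ge inf_le_left (by rw [h1, hN]))) h

lemma main {Q R : Type*} [Group Q] [Group R] [Finite Q] [Finite R] {p k : ℕ} (hp : p.Prime)
    (hQ : Nat.card Q = p ^ k) (f : Q →* R) (hf : Function.Surjective f)
    (hN : Nat.card f.ker = p) :
    ((∃ H : Subgroup Q, f.ker.IsComplement' H) → pRank Q = pRank R + 1) ∧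
    ((¬ ∃ H : Subgroup Q, f.ker.IsComplement' H) → pRank Q = pRank R) := by
  classical
  constructor
  · rintro ⟨H, hH⟩
    have hnot : ¬ f.ker ≤ frattini Q := by
      intro hle
      have h1 : H = ⊤ := by
        apply sup_frattini
        rw [eq_top_iff, ← hH.sup_eq_top, sup_comm]
        exact sup_le_sup_left hle _
      have h2 := hH.disjoint
      rw [h1, disjoint_top] at h2
      rw [h2, Subgroup.card_bot] at hN
      exact hp.one_lt.ne hN
    obtain ⟨z, hzN, hzF⟩ := SetLike.not_le_iff_exists.1 hnot
    have hzgen : f.ker = Subgroup.zpowers z := by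
      by_contra hne
      have hd := eq_zpowers (K := Subgroup.zpowers z) hp hN (fun hle => hne
        (le_antisymm hle (Subgroup.zpowers_le.2 hzN)))
      have := Subgroup.disjoint_def.1 hd hzN (Subgroup.mem_zpowers z)
      exact hzF (this ▸ one_mem _)
    apply le_antisymm
    · rw [pRank_eq, pRank_eq]
      obtain ⟨S, hS, hS'⟩ := rank_spec R
      obtain ⟨L, hL, hL'⟩ := lift_gen f hf S
      refine le_trans (Group.rank_le (S := insert z L) ?_) ((Finset.card_insert_le _ _).trans
        (by omega))
      rw [Finset.coe_insert, Set.insert_eq, Subgroup.closure_union, ← Subgroup.zpowers_eq_closure,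
        ← hzgen, sup_comm, ← Subgroup.comap_map_eq, hL', hS', Subgroup.comap_top]
    · rw [pRank_eq R, pRank]
      let A := Q ⧸ frattini Q
      let _ : CommGroup A := { (inferInstance : Group (Q ⧸ frattini Q)) with
        mul_comm := by
          intro a b
          induction a using QuotientGroup.induction_on with
          | H x =>
          induction b using QuotientGroup.induction_on with
          | H y =>
          exact QuotientGroup.eq.2 (comm_pow hp hQ x y).2 }
      obtain ⟨S, hS, hS'⟩ := rank_spec (Q ⧸ frattini Q)
      obtain ⟨T, hT, hT'⟩ := exchange (A := A) hp (by
          intro a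
          induction a using QuotientGroup.induction_on with
          | H x =>
          exact (QuotientGroup.eq_one_iff _).2 (comm_pow hp hQ x x).1)
        (QuotientGroup.mk' (frattini Q) z) (fun h => hzF ((QuotientGroup.eq_one_iff _).1 h)) S
        (by
          have : QuotientGroup.mk' (frattini Q) z ∈ (⊤ : Subgroup (Q ⧸ frattini Q)) :=
            Subgroup.mem_top _
          rw [← hS'] at this
          exact this)
      obtain ⟨L, hL, hL'⟩ := lift_gen (QuotientGroup.mk' (frattini Q))
        (QuotientGroup.mk'_surjective _) T
      have hgen : Subgroup.closure (L : Set Q) ⊔ Subgroup.zpowers z = ⊤ := by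
        apply sup_frattini
        have h3 : Subgroup.map (QuotientGroup.mk' (frattini Q))
            (Subgroup.closure (L : Set Q) ⊔ Subgroup.zpowers z) = ⊤ := by
          rw [Subgroup.map_sup, hL', MonoidHom.map_zpowers, eq_top_iff, ← hS']
          exact hT'
        have h4 := Subgroup.comap_map_eq (QuotientGroup.mk' (frattini Q))
            (Subgroup.closure (L : Set Q) ⊔ Subgroup.zpowers z)
        rw [h3, Subgroup.comap_top, QuotientGroup.ker_mk'] at h4
        exact h4.symm
      have hR : Group.rank R ≤ (L.image f).card := by
        apply Group.rank_le
        rw [Finset.coe_image, ← MonoidHom.map_closure, eq_top_iff,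
          ← Subgroup.map_top_of_surjective f hf, ← hgen, Subgroup.map_sup, ← hzgen]
        refine sup_le le_rfl ?_
        rw [(Subgroup.map_eq_bot_iff _).2 le_rfl]
        exact bot_le
      have := Finset.card_image_le (s := L) (f := f)
      rw [← hS]
      omega
  · intro hno
    rw [pRank_eq, pRank_eq]
    apply rank_eq f hf
    simp only [frattini, Order.radical, le_iInf_iff]
    intro M hM
    by_contra hle
    refine hno ⟨M, Subgroup.isComplement'_of_disjoint_and_mul_eq_univ (eq_zpowers hp hN hle) ?_⟩
    rw [← Subgroup.normal_mul, sup_comm, (hM.2 (M ⊔ f.ker)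
      (lt_of_le_of_ne le_sup_left fun h => hle (h ▸ le_sup_right)))]
    rfl

end FiltAux

theorem rank_quotient_filtration_step (p n : ℕ) (hp : p.Prime)
    (G : Type*) [Group G] [Finite G] (hG : Nat.card G = p ^ n)
    (Gser : ℕ → Subgroup G) [∀ j, (Gser j).Normal]
    (htop : Gser 0 = ⊤) (hbot : Gser n = ⊥)
    (hlt : ∀ j, j < n → Gser (j + 1) < Gser j)
    (hcard : ∀ j, j ≤ n → Nat.card (Gser j) = p ^ (n - j))
    (i : ℕ) (h1i : 1 ≤ i) (hin : i ≤ n) :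
    (splitAt Gser i → pRank (G ⧸ Gser i) = pRank (G ⧸ Gser (i - 1)) + 1) ∧
      (¬ splitAt Gser i → pRank (G ⧸ Gser i) = pRank (G ⧸ Gser (i - 1))) := by
  have hle : Gser i ≤ Gser (i - 1) := by
    have := hlt (i - 1) (by omega)
    rw [Nat.sub_add_cancel h1i] at this
    exact this.le
  have hq : ∀ j, j ≤ n → Nat.card (G ⧸ Gser j) = p ^ j := by
    intro j hj
    have h := (Gser j).card_eq_card_quotient_mul_card_subgroup
    rw [hG, hcard j hj] at h
    refine Nat.eq_of_mul_eq_mul_right (pow_pos hp.pos (n - j)) ?_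
    rw [← h, ← pow_add, Nat.add_sub_cancel' hj]
  let f : G ⧸ Gser i →* G ⧸ Gser (i - 1) :=
    QuotientGroup.map (Gser i) (Gser (i - 1)) (MonoidHom.id G) hle
  have hf : Function.Surjective f := by
    intro y
    obtain ⟨x, rfl⟩ := QuotientGroup.mk_surjective y
    exact ⟨(x : G ⧸ Gser i), rfl⟩
  have hker : f.ker = (Gser (i - 1)).map (QuotientGroup.mk' (Gser i)) :=
    QuotientGroup.ker_map _ _ _ _
  have hN : Nat.card f.ker = p := by
    have h := f.ker.card_eq_card_quotient_mul_card_subgroup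
    rw [Nat.card_congr (QuotientGroup.quotientKerEquivOfSurjective f hf).toEquiv,
      hq i hin, hq (i - 1) (by omega)] at h
    refine Nat.eq_of_mul_eq_mul_left (pow_pos hp.pos (i - 1)) ?_
    rw [← h, ← pow_succ, Nat.sub_add_cancel h1i]
  have := FiltAux.main hp (hq i hin) f hf hN
  rw [hker] at this
  exact this
end

section
/- Let p be a prime and let (G, {G_(i)}) be a p-filtered group of order p^n. Then for every 1 ≤ i ≤ n one has rank(G/G_(i)) = |Σ_G^i|; in particular rank(G) = |Σ_G|. -/
/-- The rank of a finite group is unchanged modulo a normal subgroup of the Frattini subgroup. -/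
lemma rank_quot_of_le_frattini {E : Type*} [Group E] [Finite E] (N : Subgroup E) [N.Normal]
    (h : N ≤ frattini E) : Group.rank (E ⧸ N) = Group.rank E := by
  classical
  apply le_antisymm
  · exact Group.rank_le_of_surjective (QuotientGroup.mk' N) (QuotientGroup.mk'_surjective N)
  · obtain ⟨S, hS1, hS2⟩ := Group.rank_spec (E ⧸ N)
    rw [← hS1]
    have himg : (S.image Quotient.out : Finset E).image (QuotientGroup.mk' N) = S := by
      rw [Finset.image_image]
      have hid : (⇑(QuotientGroup.mk' N) ∘ Quotient.out : E ⧸ N → E ⧸ N) = id := by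
        funext x
        exact QuotientGroup.out_eq' x
      rw [hid, Finset.image_id]
    have hcl : Subgroup.closure ((S.image Quotient.out : Finset E) : Set E) = ⊤ := by
      apply frattini_nongenerating
      rw [eq_top_iff]
      refine le_trans ?_ (sup_le_sup_left h _)
      have h1 : (Subgroup.closure ((S.image Quotient.out : Finset E) : Set E)).map
          (QuotientGroup.mk' N) = ⊤ := by
        rw [MonoidHom.map_closure, ← Finset.coe_image, himg, hS2]
      have h2 := congrArg (Subgroup.comap (QuotientGroup.mk' N)) h1
      rw [Subgroup.comap_map_eq, QuotientGroup.ker_mk', Subgroup.comap_top] at h2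
      exact h2.ge
    exact (Group.rank_le hcl).trans Finset.card_image_le

/-- Elementary abelian groups: the order is `p ^ rank`. -/
lemma card_eq_pow_rank {A : Type*} [CommGroup A] [Finite A] (p : ℕ) [Fact p.Prime]
    (h : ∀ x : A, x ^ p = 1) : Nat.card A = p ^ Group.rank A := by
  classical
  letI : Module (ZMod p) (Additive A) := AddCommGroup.zmodModule (n := p) (G := Additive A) h
  have hc : Nat.card A = p ^ Module.finrank (ZMod p) (Additive A) := by
    have := Module.natCard_eq_pow_finrank (K := ZMod p) (V := Additive A)
    rw [Nat.card_zmod] at this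
    exact this
  rw [hc]
  congr 1
  have key : ∀ s : Set (Additive A), AddSubgroup.closure s = ⊤ ↔
      Submodule.span (ZMod p) s = ⊤ := by
    intro s
    constructor
    · intro hs
      rw [eq_top_iff]
      intro x _
      have : AddSubgroup.closure s ≤ (Submodule.span (ZMod p) s).toAddSubgroup :=
        (AddSubgroup.closure_le _).2 Submodule.subset_span
      exact this (hs ▸ AddSubgroup.mem_top x)
    · intro hs
      rw [eq_top_iff]
      intro x _
      have : Submodule.span (ZMod p) s ≤ AddSubgroup.toZModSubmodule p (AddSubgroup.closure s) :=
        Submodule.span_le.2 AddSubgroup.subset_closure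
      exact this (hs ▸ Submodule.mem_top)
  have hr : Group.rank A = AddGroup.rank (Additive A) := by
    apply le_antisymm
    · obtain ⟨S, h1, h2⟩ := AddGroup.rank_spec (Additive A)
      rw [← h1]
      have : Subgroup.closure ((S.image Additive.toMul : Finset A) : Set A) = ⊤ := by
        have h3 := congrArg AddSubgroup.toSubgroup' h2
        rw [AddSubgroup.toSubgroup'_closure, map_top] at h3
        rw [Finset.coe_image]
        convert h3 using 2
        ext x
        simp
      exact (Group.rank_le this).trans Finset.card_image_le
    · obtain ⟨S, h1, h2⟩ := Group.rank_spec A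
      rw [← h1]
      have : AddSubgroup.closure ((S.image Additive.ofMul : Finset (Additive A)) :
          Set (Additive A)) = ⊤ := by
        have h3 := congrArg Subgroup.toAddSubgroup h2
        rw [Subgroup.toAddSubgroup_closure, map_top] at h3
        rw [Finset.coe_image]
        convert h3 using 2
        ext x
        simp
      exact (AddGroup.rank_le this).trans Finset.card_image_le
  rw [hr]
  apply le_antisymm
  · obtain ⟨S, h1, h2⟩ := AddGroup.rank_spec (Additive A)
    rw [← h1]
    have := finrank_span_finset_le_card (R := ZMod p) S
    rw [Set.finrank, (key _).1 h2, finrank_top] at this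
    exact this
  · let b := Module.finBasis (ZMod p) (Additive A)
    have hb : AddSubgroup.closure ((Finset.univ.image b : Finset (Additive A)) :
        Set (Additive A)) = ⊤ := by
      rw [key, Finset.coe_image, Finset.coe_univ, Set.image_univ]
      exact b.span_eq
    exact (AddGroup.rank_le hb).trans (Finset.card_image_le.trans (by simp))

lemma index_of_coatom {E : Type*} [Group E] [Finite E] {p : ℕ} [hp : Fact p.Prime]
    (hE : IsPGroup p E) (M : Subgroup E) (hM : IsCoatom M) : M.index = p := by
  obtain ⟨n, hn⟩ := IsPGroup.iff_card.1 hE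
  obtain ⟨k, hk⟩ := IsPGroup.iff_card.1 (hE.to_subgroup M)
  have hlt : Nat.card M < Nat.card E := by
    refine lt_of_le_of_ne (Nat.le_of_dvd Nat.card_pos M.card_subgroup_dvd_card) fun h => hM.1 ?_
    exact Subgroup.eq_top_of_card_eq _ h
  have hkn : k < n := by
    rw [hn, hk] at hlt
    exact (Nat.pow_lt_pow_iff_right hp.out.one_lt).1 hlt
  obtain ⟨K, hK, hMK⟩ := Sylow.exists_subgroup_card_pow_succ
    (hn ▸ pow_dvd_pow p hkn : p ^ (k + 1) ∣ Nat.card E) hk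
  have hne : M < K := by
    refine lt_of_le_of_ne hMK fun h => ?_
    rw [← h, hk] at hK
    have := Nat.pow_right_injective hp.out.two_le hK
    omega
  have hKt := hM.2 K hne
  rw [hKt, Subgroup.card_top] at hK
  have := M.card_mul_index
  rw [hK, hk, pow_succ] at this
  exact Nat.eq_of_mul_eq_mul_left (pow_pos hp.out.pos k) this

lemma normal_of_index {E : Type*} [Group E] [Finite E] {p : ℕ} [hp : Fact p.Prime]
    (hE : IsPGroup p E) (M : Subgroup E) (hM : M.index = p) : M.Normal := by
  obtain ⟨n, hn⟩ := IsPGroup.iff_card.1 hE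
  apply Subgroup.normal_of_index_eq_minFac_card
  rw [hM, hn, hp.out.pow_minFac]
  rintro rfl
  have := M.index_dvd_card
  rw [hM, hn, pow_zero, Nat.dvd_one] at this
  exact hp.out.one_lt.ne' this

lemma frattini_pgroup {E : Type*} [Group E] [Finite E] {p : ℕ} [hp : Fact p.Prime]
    (hE : IsPGroup p E) : (∀ x : E, x ^ p ∈ frattini E) ∧
      ∀ x y : E, (x * y)⁻¹ * (y * x) ∈ frattini E := by
  have key : ∀ z : E, (∀ M : Subgroup E, IsCoatom M → z ∈ M) → z ∈ frattini E := by
    intro z hz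
    simp only [frattini, Order.radical, Subgroup.mem_iInf]
    exact hz
  constructor
  · intro x
    refine key _ fun M hM => ?_
    have hi := index_of_coatom hE M hM
    haveI := normal_of_index hE M hi
    rw [← QuotientGroup.eq_one_iff, QuotientGroup.mk_pow, ← hi, Subgroup.index]
    exact pow_card_eq_one'
  · intro x y
    refine key _ fun M hM => ?_
    have hi := index_of_coatom hE M hM
    haveI := normal_of_index hE M hi
    haveI : IsCyclic (E ⧸ M) := isCyclic_of_prime_card (p := p) hi
    rw [← QuotientGroup.eq, QuotientGroup.mk_mul, QuotientGroup.mk_mul]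
    exact mul_comm' _ _

lemma rank_prod_prime {Q C : Type*} [Group Q] [Finite Q] [Group C] [Finite C] {p : ℕ}
    [hp : Fact p.Prime] (hQ : IsPGroup p Q) (hC : Nat.card C = p) :
    Group.rank (Q × C) = Group.rank Q + 1 := by
  classical
  haveI : IsCyclic C := isCyclic_of_prime_card (p := p) hC
  apply le_antisymm
  · obtain ⟨S, h1, h2⟩ := Group.rank_spec Q
    obtain ⟨c, hc⟩ := IsCyclic.exists_generator (α := C)
    rw [← h1]
    let T : Finset (Q × C) := insert (1, c) (S.image fun q => (q, 1))
    have hT : Subgroup.closure (T : Set (Q × C)) = ⊤ := by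
      rw [eq_top_iff]
      rintro ⟨q, d⟩ -
      have hq : ((q, 1) : Q × C) ∈ Subgroup.closure (T : Set (Q × C)) := by
        have : Subgroup.closure (S : Set Q) ≤
            (Subgroup.closure (T : Set (Q × C))).comap (MonoidHom.inl Q C) := by
          rw [Subgroup.closure_le]
          intro s hs
          apply Subgroup.subset_closure
          simp only [T, Finset.coe_insert, Finset.coe_image]
          exact Or.inr ⟨s, hs, rfl⟩
        exact this (h2 ▸ Subgroup.mem_top q)
      have hd : ((1, d) : Q × C) ∈ Subgroup.closure (T : Set (Q × C)) := by
        obtain ⟨k, rfl⟩ := Subgroup.mem_zpowers_iff.1 (hc d)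
        have : ((1, c) : Q × C) ∈ Subgroup.closure (T : Set (Q × C)) :=
          Subgroup.subset_closure (by simp [T])
        have := Subgroup.zpow_mem _ this k
        simpa using this
      simpa using Subgroup.mul_mem _ hq hd
    exact (Group.rank_le hT).trans ((Finset.card_insert_le _ _).trans
      (Nat.succ_le_succ Finset.card_image_le))
  · obtain ⟨hpow, hcomm⟩ := frattini_pgroup hQ
    letI : CommGroup (Q ⧸ frattini Q) :=
      { (inferInstance : Group (Q ⧸ frattini Q)) with
        mul_comm := by
          intro a b
          induction a using QuotientGroup.induction_on with | _ x
          induction b using QuotientGroup.induction_on with | _ y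
          rw [← QuotientGroup.mk_mul, ← QuotientGroup.mk_mul]
          exact QuotientGroup.eq.2 (hcomm x y) }
    have hqp : ∀ a : Q ⧸ frattini Q, a ^ p = 1 := by
      intro a
      induction a using QuotientGroup.induction_on with | _ x
      rw [← QuotientGroup.mk_pow]
      exact (QuotientGroup.eq_one_iff _).2 (hpow x)
    letI : CommGroup C := IsCyclic.commGroup
    have hcp : ∀ a : C, a ^ p = 1 := fun a => hC ▸ pow_card_eq_one'
    have e1 := card_eq_pow_rank p hqp
    have e2 := card_eq_pow_rank (A := (Q ⧸ frattini Q) × C) p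
      (fun a => Prod.ext (hqp a.1) (hcp a.2))
    rw [Nat.card_prod, hC, e1, ← pow_succ] at e2
    have e3 := Nat.pow_right_injective hp.out.two_le e2
    have e4 := rank_quot_of_le_frattini (frattini Q) le_rfl
    have e5 := Group.rank_le_of_surjective
      ((QuotientGroup.mk' (frattini Q)).prodMap (MonoidHom.id C))
      (Function.Surjective.prodMap (QuotientGroup.mk'_surjective _) Function.surjective_id)
    rw [← e4]
    exact e3.le.trans e5

open Classical in
lemma rank_step {E : Type*} [Group E] [Finite E] {p : ℕ} [hp : Fact p.Prime]
    (hE : IsPGroup p E) (N : Subgroup E) [N.Normal] (hN : Nat.card N = p) :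
    Group.rank E = Group.rank (E ⧸ N) + if ∃ H : Subgroup E, N.IsComplement' H then 1 else 0 := by
  split_ifs with h
  · obtain ⟨H, hH⟩ := h
    have hi : H.index = p := hH.index_eq_card.trans hN
    haveI := normal_of_index hE H hi
    let f : E →* (E ⧸ N) × (E ⧸ H) := (QuotientGroup.mk' N).prod (QuotientGroup.mk' H)
    have hinj : Function.Injective f := by
      rw [injective_iff_map_eq_one]
      intro x hx
      have h1 : x ∈ N := (QuotientGroup.eq_one_iff x).1 (congrArg Prod.fst hx)
      have h2 : x ∈ H := (QuotientGroup.eq_one_iff x).1 (congrArg Prod.snd hx)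
      exact Subgroup.disjoint_def.1 hH.disjoint h1 h2
    have hcard : Nat.card E = Nat.card ((E ⧸ N) × (E ⧸ H)) := by
      rw [Nat.card_prod]
      change _ = N.index * H.index
      rw [hi, ← hN, N.index_mul_card]
    have hbij : Function.Bijective f := (Nat.bijective_iff_injective_and_card f).2 ⟨hinj, hcard⟩
    rw [Group.rank_congr (MulEquiv.ofBijective f hbij)]
    exact rank_prod_prime (hE.to_quotient N) hi
  · rw [add_zero]
    refine (rank_quot_of_le_frattini N ?_).symm
    by_contra hle
    apply h
    have : ∃ M : Subgroup E, IsCoatom M ∧ ¬ N ≤ M := by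
      by_contra! hcon
      apply hle
      simp only [frattini, Order.radical, le_iInf_iff]
      exact hcon
    obtain ⟨M, hM, hNM⟩ := this
    have hi := index_of_coatom hE M hM
    refine ⟨M, Subgroup.isComplement'_of_card_mul_and_disjoint ?_ ?_⟩
    · rw [hN, ← hi, M.index_mul_card]
    · rw [disjoint_iff]
      have hd : Nat.card (N ⊓ M : Subgroup E) ∣ Nat.card N :=
        Subgroup.card_dvd_of_le inf_le_left
      rw [hN] at hd
      rcases (Nat.dvd_prime hp.out).1 hd with h1 | h1
      · exact Subgroup.card_eq_one.1 h1
      · exfalso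
        apply hNM
        have : N ⊓ M = N := Subgroup.eq_of_le_of_card_ge inf_le_left (by rw [h1, hN])
        exact inf_eq_left.1 this

lemma rank_main (p n : ℕ) (hp : p.Prime)
    (G : Type*) [Group G] [Finite G] (hG : Nat.card G = p ^ n)
    (Gser : ℕ → Subgroup G) [∀ j, (Gser j).Normal]
    (htop : Gser 0 = ⊤)
    (hlt : ∀ j, j < n → Gser (j + 1) < Gser j)
    (hcard : ∀ j, j ≤ n → Nat.card (Gser j) = p ^ (n - j)) (i : ℕ) (hi : i ≤ n) :
    Group.rank (G ⧸ Gser i) = Nat.card {j : ℕ // 1 ≤ j ∧ j ≤ i ∧ splitAt Gser j} := by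
  classical
  haveI : Fact p.Prime := ⟨hp⟩
  have hPG : IsPGroup p G := IsPGroup.of_card hG
  have hset : ∀ i, Nat.card {j : ℕ // 1 ≤ j ∧ j ≤ i ∧ splitAt Gser j} =
      ((Finset.Icc 1 i).filter (splitAt Gser)).card := by
    intro i
    rw [Nat.subtype_card]
    intro x
    simp [and_assoc]
  rw [hset]
  induction i with
  | zero =>
    haveI : Subsingleton (G ⧸ Gser 0) := by
      rw [htop]; exact QuotientGroup.subsingleton_quotient_top
    rw [Group.rank_eq_zero]
    simp
  | succ i ih =>
    have ih := ih (by omega)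
    have hle := (hlt i (by omega)).le
    let N : Subgroup (G ⧸ Gser (i + 1)) := (Gser i).map (QuotientGroup.mk' (Gser (i + 1)))
    haveI : N.Normal := Subgroup.Normal.map inferInstance _ (QuotientGroup.mk'_surjective _)
    have e : (G ⧸ Gser (i + 1)) ⧸ N ≃* G ⧸ Gser i :=
      QuotientGroup.quotientQuotientEquivQuotient (Gser (i + 1)) (Gser i) hle
    have hidx : ∀ j, j ≤ n → Nat.card (G ⧸ Gser j) = p ^ j := by
      intro j hj
      have h1 := (Gser j).index_mul_card
      rw [hcard j hj, hG] at h1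
      have h2 : p ^ n = p ^ j * p ^ (n - j) := by rw [← pow_add]; congr 1; omega
      rw [h2] at h1
      exact Nat.eq_of_mul_eq_mul_right (pow_pos hp.pos _) h1
    have hN : Nat.card N = p := by
      have h1 := N.index_mul_card
      have h2 : N.index = p ^ i := (Nat.card_congr e.toEquiv).trans (hidx i (by omega))
      rw [hidx (i + 1) hi, h2, pow_succ] at h1
      exact Nat.eq_of_mul_eq_mul_left (pow_pos hp.pos _) h1
    have hs := rank_step (hPG.to_quotient (Gser (i + 1))) N hN
    have hsp : (∃ H : Subgroup (G ⧸ Gser (i + 1)), N.IsComplement' H) ↔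
      splitAt Gser (i + 1) := Iff.rfl
    rw [hs, Group.rank_congr e, ih, ← Finset.insert_Icc_right_eq_Icc_add_one (by omega),
      Finset.filter_insert]
    by_cases hc : splitAt Gser (i + 1)
    · rw [if_pos hc, if_pos (hsp.2 hc), Finset.card_insert_of_notMem (by simp)]
    · rw [if_neg hc, if_neg (fun h => hc (hsp.1 h)), add_zero]

theorem rank_quotient_eq_card_split (p n : ℕ) (hp : p.Prime)
    (G : Type*) [Group G] [Finite G] (hG : Nat.card G = p ^ n)
    (Gser : ℕ → Subgroup G) [∀ j, (Gser j).Normal]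
    (htop : Gser 0 = ⊤) (hbot : Gser n = ⊥)
    (hlt : ∀ j, j < n → Gser (j + 1) < Gser j)
    (hcard : ∀ j, j ≤ n → Nat.card (Gser j) = p ^ (n - j)) :
    (∀ i, 1 ≤ i → i ≤ n →
        pRank (G ⧸ Gser i) = Nat.card {j : ℕ // 1 ≤ j ∧ j ≤ n ∧ j ≤ i ∧ splitAt Gser j}) ∧
      pRank G = Nat.card {j : ℕ // 1 ≤ j ∧ j ≤ n ∧ splitAt Gser j} := by
  have hm := rank_main p n hp G hG Gser htop hlt hcard
  constructor
  · intro i _ hi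
    rw [pRank, rank_quot_of_le_frattini _ le_rfl, hm i hi]
    refine Nat.card_congr (Equiv.subtypeEquivRight fun j => ?_)
    constructor
    · rintro ⟨h1, h2, h3⟩
      exact ⟨h1, h2.trans hi, h2, h3⟩
    · rintro ⟨h1, _, h2, h3⟩
      exact ⟨h1, h2, h3⟩
  · rw [pRank, rank_quot_of_le_frattini _ le_rfl, ← hm n le_rfl]
    exact Group.rank_congr
      ((QuotientGroup.quotientBot (G := G)).symm.trans
        (QuotientGroup.quotientMulEquivOfEq hbot.symm))
end

section
/- Let (G, {G_(i)}) be a p-filtered group of order p^n. Then for 1 ≤ i ≤ n there exist polynomials D_i ∈ F_p[Y_1,...,Y_{i-1}] with the following properties: (a) D_i = 0 for i ∈ Σ_G, and D_i ∉ F_p for i ∉ Σ_G; (b) setting R_i = F_p[X_1,...,X_i], S_0 = F_p, and S_i = S_{i-1}[Y_i, X_i]/(Y_i^p − Y_i − D_i − X_i) for 1 ≤ i ≤ n, one has S_i ≅ F_p[Y_1,...,Y_i] and S_i/R_i is a Galois extension of rings; (c) there are isomorphisms λ_i : Gal(S_i/R_i) → G/G_(i) such that for each 1 ≤ i ≤ n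 the isomorphisms λ_i and λ_{i-1} are compatible with the restriction map Gal(S_i/R_i) → Gal(S_{i-1}/R_{i-1}) and the canonical projection G/G_(i) → G/G_(i-1). -/
/-!
STATEMENT 7 (Proposition 3.5 of the paper, after Saltman):
Let (G, {G_(i)}) be a p-filtered group of order p^n.  Then for 1 ≤ i ≤ n there are
polynomials D_i ∈ F_p[Y_1,...,Y_{i-1}] such that:
(a) D_i = 0 for i ∈ Σ_G, and D_i ∉ F_p for i ∉ Σ_G;
(b) with R_i = F_p[X_1,...,X_i] (X_j := Y_j^p − Y_j − D_j(Y_1,...,Y_{j-1})) inside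
    S_i = F_p[Y_1,...,Y_i], the extension S_i/R_i is Galois with group G/G_(i);
(c) the isomorphisms Gal(S_i/R_i) ≅ G/G_(i) are compatible with restriction
    S_i → S_{i-1} and the canonical projections G/G_(i) → G/G_(i-1).
(Here we realize S_i directly as the polynomial ring F_p[Y_1,...,Y_i], which the paper
shows is isomorphic to the iterated Artin–Schreier extension.)
-/

open MvPolynomial

/-- The element `X_j = Y_j^p − Y_j − D_j(Y_1,...,Y_{j-1})` of `S_i = F_p[Y_1,...,Y_i]`. -/
noncomputable def Xelt (p : ℕ) (D : (j : ℕ) → MvPolynomial (Fin (j - 1)) (ZMod p))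
    (i j : ℕ) (h : j - 1 < i) : MvPolynomial (Fin i) (ZMod p) :=
  X (⟨j - 1, h⟩ : Fin i) ^ p - X (⟨j - 1, h⟩ : Fin i) -
    rename (Fin.castLE (le_of_lt h)) (D j)

/-- The set of generators `X_1, ..., X_i` of the subring `R_i` of `S_i`. -/
noncomputable def XeltSet (p : ℕ) (D : (j : ℕ) → MvPolynomial (Fin (j - 1)) (ZMod p))
    (i : ℕ) : Set (MvPolynomial (Fin i) (ZMod p)) :=
  {q | ∃ (j : ℕ) (h1 : 1 ≤ j) (h2 : j ≤ i), q = Xelt p D i j (by omega)}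


/-- Additive coordinate on `A` with kernel `B`. -/
structure IsIota {G : Type*} [Group G] (p : ℕ) (A B : Subgroup G) (i : G → ZMod p) : Prop where
  mul : ∀ a ∈ A, ∀ b ∈ A, i (a * b) = i a + i b
  ker : ∀ a ∈ A, i a = 0 ↔ a ∈ B
  surj : ∀ c, ∃ a ∈ A, i a = c
  conj : ∀ g, ∀ a ∈ A, i (g⁻¹ * a * g) = i a

theorem exists_iota {G : Type*} [Group G] {p n : ℕ} [Fact p.Prime] (hG : Nat.card G = p ^ n)
    (A B : Subgroup G) [A.Normal] [B.Normal] (hAB : B ≤ A)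
    (hcard : Nat.card A = p * Nat.card B) (hB : Nat.card B ≠ 0) :
    ∃ i : G → ZMod p, IsIota p A B i := by
  classical
  have hq : Nat.card (A ⧸ B.subgroupOf A) = p := by
    have h1 := Subgroup.card_eq_card_quotient_mul_card_subgroup (B.subgroupOf A)
    have h2 : Nat.card (B.subgroupOf A) = Nat.card B :=
      Nat.card_congr (Subgroup.subgroupOfEquivOfLe hAB).toEquiv
    rw [h2, hcard] at h1
    exact (Nat.eq_of_mul_eq_mul_right (Nat.pos_of_ne_zero hB) h1).symm
  let e : (A ⧸ B.subgroupOf A) ≃* Multiplicative (ZMod p) :=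
    mulEquivOfPrimeCardEq (p := p) hq (by simp)
  let i : G → ZMod p := fun g => if h : g ∈ A then
    Multiplicative.toAdd (e (QuotientGroup.mk ⟨g, h⟩)) else 0
  have hi : ∀ g (h : g ∈ A), i g = Multiplicative.toAdd (e (QuotientGroup.mk ⟨g, h⟩)) :=
    fun g h => by simp [i, h]
  have hmul : ∀ a ∈ A, ∀ b ∈ A, i (a * b) = i a + i b := by
    intro a ha b hb
    rw [hi _ ha, hi _ hb, hi _ (A.mul_mem ha hb), ← toAdd_mul, ← map_mul]
    rfl
  have hker : ∀ a ∈ A, i a = 0 ↔ a ∈ B := by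
    intro a ha
    rw [hi _ ha, toAdd_eq_zero, map_eq_one_iff e e.injective, QuotientGroup.eq_one_iff,
      Subgroup.mem_subgroupOf]
  have hsurj : ∀ c, ∃ a ∈ A, i a = c := by
    intro c
    obtain ⟨x, hx⟩ := e.surjective (Multiplicative.ofAdd c)
    obtain ⟨⟨a, ha⟩, rfl⟩ := QuotientGroup.mk_surjective x
    exact ⟨a, ha, by rw [hi _ ha, hx]; rfl⟩
  refine ⟨i, hmul, hker, hsurj, ?_⟩
  intro g
  have hc : ∀ g : G, ∀ a ∈ A, g⁻¹ * a * g ∈ A := fun g a ha => by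
    simpa using Subgroup.Normal.conj_mem ‹A.Normal› a ha g⁻¹
  have hcB : ∀ g : G, ∀ a ∈ B, g⁻¹ * a * g ∈ B := fun g a ha => by
    simpa using Subgroup.Normal.conj_mem ‹B.Normal› a ha g⁻¹
  have h1 : i 1 = 0 := (hker 1 A.one_mem).2 B.one_mem
  have hpow : ∀ a ∈ A, ∀ k : ℕ, i (a ^ k) = k * i a := by
    intro a ha k
    induction k with
    | zero => simpa using h1
    | succ k ih => rw [pow_succ, hmul _ (A.pow_mem ha k) _ ha, ih]; push_cast; ring
  obtain ⟨a0, ha0, ha01⟩ := hsurj 1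
  -- equality in ι depends only on ι
  have hinv : ∀ a ∈ A, i a⁻¹ = - i a := by
    intro a ha
    have := hmul a ha a⁻¹ (A.inv_mem ha)
    rw [mul_inv_cancel, h1] at this
    linear_combination -this
  have hcong : ∀ g : G, ∀ a ∈ A, ∀ b ∈ A, i a = i b → i (g⁻¹ * a * g) = i (g⁻¹ * b * g) := by
    intro g a ha b hb hab
    have h2 : a⁻¹ * b ∈ B := by
      rw [← hker _ (A.mul_mem (A.inv_mem ha) hb), hmul _ (A.inv_mem ha) _ hb, hinv a ha, hab]
      ring
    have h3 : i (g⁻¹ * (a⁻¹ * b) * g) = 0 := (hker _ (hc g _ (hAB h2))).2 (hcB g _ h2)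
    have h4 : g⁻¹ * b * g = (g⁻¹ * a * g) * (g⁻¹ * (a⁻¹ * b) * g) := by group
    rw [h4, hmul _ (hc g a ha) _ (hc g _ (hAB h2)), h3, add_zero]
  have hlin : ∀ g : G, ∀ a ∈ A, i (g⁻¹ * a * g) = i a * i (g⁻¹ * a0 * g) := by
    intro g a ha
    have h5 : i a = i (a0 ^ (i a).val) := by
      rw [hpow a0 ha0, ha01]; simp
    rw [hcong g a ha _ (A.pow_mem ha0 _) h5]
    have : g⁻¹ * a0 ^ (i a).val * g = (g⁻¹ * a0 * g) ^ (i a).val := by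
      have := conj_pow (a := g⁻¹) (b := a0) (i := (i a).val)
      simpa using this.symm
    rw [this, hpow _ (hc g a0 ha0)]
    simp
  have hit : ∀ k : ℕ, i ((g ^ k)⁻¹ * a0 * g ^ k) = i (g⁻¹ * a0 * g) ^ k := by
    intro k
    induction k with
    | zero => simpa using ha01
    | succ k ih =>
      have : (g ^ (k+1))⁻¹ * a0 * g ^ (k+1) = g⁻¹ * ((g ^ k)⁻¹ * a0 * g ^ k) * g := by
        rw [pow_succ]; group
      rw [this, hlin g _ (hc _ _ ha0), ih, pow_succ]
  have hfin := hit (p ^ n)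
  rw [← hG, pow_card_eq_one', hG, ZMod.pow_card_pow] at hfin
  intro a ha
  rw [hlin g a ha, ← hfin]
  simp [ha01]

theorem IsIota.one {G : Type*} [Group G] {p : ℕ} {A B : Subgroup G} {i : G → ZMod p}
    (h : IsIota p A B i) : i 1 = 0 := (h.ker 1 A.one_mem).2 B.one_mem

theorem IsIota.inv {G : Type*} [Group G] {p : ℕ} {A B : Subgroup G} {i : G → ZMod p}
    (h : IsIota p A B i) (a) (ha : a ∈ A) : i a⁻¹ = - i a := by
  have := h.mul a ha a⁻¹ (A.inv_mem ha)
  rw [mul_inv_cancel, h.one] at this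
  linear_combination -this

/-- split gives hom extending iota -/
theorem split_to_hom {G : Type*} [Group G] {p : ℕ} {A B : Subgroup G} [A.Normal] [B.Normal]
    {i : G → ZMod p} (hi : IsIota p A B i)
    (H : Subgroup (G ⧸ B)) (hH : (A.map (QuotientGroup.mk' B)).IsComplement' H) :
    ∃ χ : G → ZMod p, (∀ g h, χ (g * h) = χ g + χ h) ∧ ∀ a ∈ A, χ a = i a := by
  have hex : ∀ g : G, ∃ a ∈ A, (QuotientGroup.mk (a⁻¹ * g) : G ⧸ B) ∈ H := by
    intro g
    obtain ⟨⟨⟨x, hx⟩, ⟨y, hy⟩⟩, hxy⟩ := hH.2 (QuotientGroup.mk g)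
    obtain ⟨a, ha, rfl⟩ := hx
    refine ⟨a, ha, ?_⟩
    convert hy
    simp only at hxy
    rw [QuotientGroup.mk_mul, ← hxy]
    simp
  have huniq : ∀ g : G, ∀ a ∈ A, ∀ b ∈ A, (QuotientGroup.mk (a⁻¹ * g) : G ⧸ B) ∈ H →
      (QuotientGroup.mk (b⁻¹ * g) : G ⧸ B) ∈ H → i a = i b := by
    intro g a ha b hb h1 h2
    have h3 : (QuotientGroup.mk (a⁻¹ * b) : G ⧸ B) ∈ H := by
      have := H.mul_mem h1 (H.inv_mem h2)
      rw [← QuotientGroup.mk_inv, ← QuotientGroup.mk_mul] at this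
      convert this using 2
      group
    have h4 : (QuotientGroup.mk (a⁻¹ * b) : G ⧸ B) ∈ A.map (QuotientGroup.mk' B) :=
      ⟨a⁻¹ * b, A.mul_mem (A.inv_mem ha) hb, rfl⟩
    have h5 := Subgroup.disjoint_def.1 hH.disjoint h4 h3
    rw [QuotientGroup.eq_one_iff, ← hi.ker _ (A.mul_mem (A.inv_mem ha) hb),
      hi.mul _ (A.inv_mem ha) _ hb, hi.inv a ha] at h5
    linear_combination -h5
  choose s hs hsH using hex
  have key : ∀ g, ∀ a ∈ A, (QuotientGroup.mk (a⁻¹ * g) : G ⧸ B) ∈ H → i (s g) = i a :=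
    fun g a ha h => huniq g _ (hs g) a ha (hsH g) h
  refine ⟨fun g => i (s g), ?_, ?_⟩
  · intro g h
    -- g = a u, h = b v; g h = a b (b⁻¹ u b u⁻¹) u v, up to B
    have hcm : (QuotientGroup.mk (s h)⁻¹ * QuotientGroup.mk ((s g)⁻¹ * g) : G ⧸ B) =
        QuotientGroup.mk ((s g)⁻¹ * g) * QuotientGroup.mk (s h)⁻¹ := by
      rw [← QuotientGroup.mk_mul, ← QuotientGroup.mk_mul, QuotientGroup.eq]
      set u := (s g)⁻¹ * g
      have hm : u * (s h)⁻¹ * u⁻¹ ∈ A :=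
        Subgroup.Normal.conj_mem ‹A.Normal› _ (A.inv_mem (hs h)) u
      have e2 : ((s h)⁻¹ * u)⁻¹ * (u * (s h)⁻¹) =
        u⁻¹ * ((s h) * (u * (s h)⁻¹ * u⁻¹)) * u := by group
      rw [e2]
      have hA := A.mul_mem (hs h) hm
      have hA' : u⁻¹ * ((s h) * (u * (s h)⁻¹ * u⁻¹)) * u ∈ A := by
        simpa using Subgroup.Normal.conj_mem ‹A.Normal› _ hA u⁻¹
      rw [← hi.ker _ hA', hi.conj u _ hA, hi.mul _ (hs h) _ hm]
      have := hi.conj u⁻¹ _ (A.inv_mem (hs h))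
      rw [inv_inv] at this
      rw [this, hi.inv _ (hs h)]
      ring
    simp only
    rw [← hi.mul _ (hs g) _ (hs h)]
    apply key _ _ (A.mul_mem (hs g) (hs h))
    have := H.mul_mem (hsH g) (hsH h)
    convert this using 1
    rw [QuotientGroup.mk_mul B (s h)⁻¹ h,
      ← mul_assoc (QuotientGroup.mk ((s g)⁻¹ * g) : G ⧸ B), ← hcm]
    rw [← QuotientGroup.mk_mul, ← QuotientGroup.mk_mul]
    congr 1
    group
  · intro a ha
    apply key _ _ ha
    rw [inv_mul_cancel]
    exact H.one_mem

theorem hom_to_split {G : Type*} [Group G] {p : ℕ} {A B : Subgroup G} [A.Normal] [B.Normal]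
    (hAB : B ≤ A)
    {i : G → ZMod p} (hi : IsIota p A B i) {S : Type*} [AddCommGroup S]
    (χ : G → S) (hχ : ∀ g h, χ (g * h) = χ g + χ h) (h0 : ∀ a ∈ A, χ a = 0 → i a = 0)
    (hs : ∀ g, ∃ a ∈ A, χ a = χ g) :
    ∃ H : Subgroup (G ⧸ B), (A.map (QuotientGroup.mk' B)).IsComplement' H := by
  let f : G →* Multiplicative S := MonoidHom.mk' (fun g => Multiplicative.ofAdd (χ g))
    (fun g h => by rw [hχ]; rfl)
  have hf : ∀ g, g ∈ f.ker ↔ χ g = 0 := fun g => by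
    rw [MonoidHom.mem_ker]; exact Iff.rfl
  refine ⟨f.ker.map (QuotientGroup.mk' B), ?_⟩
  apply Subgroup.isComplement'_of_disjoint_and_mul_eq_univ
  · rw [Subgroup.disjoint_def]
    rintro x ⟨a, ha, rfl⟩ ⟨k, hk, hka⟩
    have hk' : χ k = 0 := (hf k).1 hk
    simp only [QuotientGroup.mk'_apply] at hka ⊢
    have h1 : k⁻¹ * a ∈ B := QuotientGroup.eq.1 hka
    have hkA : k ∈ A := by
      have := A.mul_mem ha (A.inv_mem (hAB h1))
      simpa using this
    rw [← hka, QuotientGroup.eq_one_iff, ← hi.ker k hkA]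
    exact h0 k hkA hk'
  · rw [Set.eq_univ_iff_forall]
    intro x
    obtain ⟨g, rfl⟩ := QuotientGroup.mk_surjective x
    obtain ⟨a, ha, hag⟩ := hs g
    refine Set.mem_mul.2 ⟨QuotientGroup.mk a, ⟨a, ha, rfl⟩, QuotientGroup.mk (a⁻¹ * g),
      ⟨a⁻¹ * g, ?_, rfl⟩, ?_⟩
    · refine (hf _).2 ?_
      have := hχ a (a⁻¹ * g)
      rw [mul_inv_cancel_left, hag] at this
      simpa using this
    · rw [← QuotientGroup.mk_mul, mul_inv_cancel_left]

/-- Sum over representatives of cosets. -/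
noncomputable def cosetSum {G : Type*} [Group G] [Finite G] (A : Subgroup G) {S : Type*}
    [AddCommMonoid S] (h : G → S) : S :=
  letI := Fintype.ofFinite (G ⧸ A)
  ∑ x : G ⧸ A, h (Quotient.out x)

theorem cosetSum_out {G : Type*} [Group G] {A : Subgroup G} {S : Type*}
    (h : G → S) (hA : ∀ y, ∀ a ∈ A, h (y * a) = h y) (y : G) :
    h (Quotient.out (QuotientGroup.mk y : G ⧸ A)) = h y := by
  have : y⁻¹ * Quotient.out (QuotientGroup.mk y : G ⧸ A) ∈ A := by
    rw [← QuotientGroup.eq, QuotientGroup.out_eq']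
  have h2 := hA y _ this
  rwa [mul_inv_cancel_left] at h2

theorem cosetSum_translate {G : Type*} [Group G] [Finite G] {A : Subgroup G} {S : Type*}
    [AddCommMonoid S] (k h : G → S) (g : G) (hk : ∀ y, k y = h (g * y))
    (hA : ∀ y, ∀ a ∈ A, h (y * a) = h y) :
    cosetSum A k = cosetSum A h := by
  classical
  let _ := Fintype.ofFinite (G ⧸ A)
  unfold cosetSum
  conv_rhs => rw [← Equiv.sum_comp (MulAction.toPerm (α := G) (β := G ⧸ A) g)]
  refine Finset.sum_congr rfl fun x _ => ?_
  have h2 := cosetSum_out (A := A) h hA (g * Quotient.out x)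
  rw [hk, ← h2]
  congr 2
  conv_rhs => rw [← QuotientGroup.out_eq' x]
  rfl

theorem cosetSum_add {G : Type*} [Group G] [Finite G] {A : Subgroup G} {S : Type*}
    [AddCommMonoid S] (h k : G → S) :
    cosetSum A (fun y => h y + k y) = cosetSum A h + cosetSum A k := by
  unfold cosetSum
  exact Finset.sum_add_distrib

theorem cosetSum_mul {G : Type*} [Group G] [Finite G] {A : Subgroup G} {S : Type*}
    [CommRing S] (c : S) (k : G → S) :
    cosetSum A (fun y => c * k y) = c * cosetSum A k := by
  unfold cosetSum
  exact Finset.mul_sum _ _ _ |>.symm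

theorem cosetSum_map {G : Type*} [Group G] [Finite G] {A : Subgroup G} {S T : Type*}
    [CommRing S] [CommRing T] (e : S →+* T) (k : G → S) :
    e (cosetSum A k) = cosetSum A (fun y => e (k y)) := by
  unfold cosetSum
  exact map_sum _ _ _

theorem ringAut_algebraMap {p : ℕ} {S : Type*} [CommRing S] [Algebra (ZMod p) S]
    (e : S →+* S) (c : ZMod p) : e (algebraMap (ZMod p) S c) = algebraMap (ZMod p) S c := by
  have : e.comp (algebraMap (ZMod p) S) = algebraMap (ZMod p) S := Subsingleton.elim _ _
  exact RingHom.congr_fun this c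

theorem exists_of_pow_eq_aux {K : Type*} [Field K] [Fintype K] {S : Type*} [CommRing S] [IsDomain S]
    [Algebra K S] (x : S) (hx : x ^ Fintype.card K = x) : ∃ c : K, x = algebraMap K S c := by
  classical
  by_contra hcon
  have hp1 : 1 < Fintype.card K := Fintype.one_lt_card
  have inj := (algebraMap K S).injective
  have hdeg : (Polynomial.X ^ Fintype.card K - Polynomial.X : Polynomial S).natDegree =
      Fintype.card K := by
    rw [Polynomial.natDegree_sub_eq_left_of_natDegree_lt, Polynomial.natDegree_X_pow]
    rw [Polynomial.natDegree_X_pow, Polynomial.natDegree_X]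
    exact hp1
  have hne : (Polynomial.X ^ Fintype.card K - Polynomial.X : Polynomial S) ≠ 0 := by
    intro h
    rw [h, Polynomial.natDegree_zero] at hdeg
    omega
  have hcard : (insert x (Finset.univ.image (algebraMap K S))).card = Fintype.card K + 1 := by
    rw [Finset.card_insert_of_notMem, Finset.card_image_of_injective _ inj, Finset.card_univ]
    intro h
    obtain ⟨c, -, hc⟩ := Finset.mem_image.1 h
    exact hcon ⟨c, hc.symm⟩
  apply hne
  refine Polynomial.eq_zero_of_natDegree_lt_card_of_eval_eq_zero' _
      (insert x (Finset.univ.image (algebraMap K S))) ?_ ?_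
  · intro y hy
    rw [Polynomial.eval_sub, Polynomial.eval_pow, Polynomial.eval_X, sub_eq_zero]
    rcases Finset.mem_insert.1 hy with h | h
    · rw [h, hx]
    · obtain ⟨c, -, hc⟩ := Finset.mem_image.1 h
      rw [← hc, ← map_pow, FiniteField.pow_card]
  · rw [hcard, hdeg]
    exact Nat.lt_succ_self _

theorem exists_of_pow_eq {p : ℕ} [hp : Fact p.Prime] {S : Type*} [CommRing S] [IsDomain S]
    [Algebra (ZMod p) S] (x : S) (hx : x ^ p = x) : ∃ c : ZMod p, x = algebraMap (ZMod p) S c :=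
  exists_of_pow_eq_aux x (by rw [ZMod.card]; exact hx)

/-- The cocycle step. -/
theorem cocycle_step {G : Type*} [Group G] [Finite G] {p : ℕ} [Fact p.Prime]
    {A B : Subgroup G} [A.Normal] [B.Normal] (hAB : B ≤ A)
    {i : G → ZMod p} (hi : IsIota p A B i)
    {S : Type*} [CommRing S] [IsDomain S] [Algebra (ZMod p) S]
    (r : G →* RingAut S) (hr : ∀ a ∈ A, r a = 1) (t : S)
    (ht : cosetSum A (fun y => r y t) = 1) :
    ∃ (f : G → S) (D : S), (∀ g h, f (g * h) = f g + r g (f h)) ∧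
      (∀ a ∈ A, f a = algebraMap (ZMod p) S (i a)) ∧
      (∀ g, f g ^ p - f g = r g D - D) ∧
      ((∃ H : Subgroup (G ⧸ B), (A.map (QuotientGroup.mk' B)).IsComplement' H) → D = 0) ∧
      ((¬ ∃ H : Subgroup (G ⧸ B), (A.map (QuotientGroup.mk' B)).IsComplement' H) →
        ∀ c, D ≠ algebraMap (ZMod p) S c) := by
  classical
  have hchar : CharP S p := charP_of_injective_algebraMap (algebraMap (ZMod p) S).injective p
  by_cases hsp : ∃ H : Subgroup (G ⧸ B), (A.map (QuotientGroup.mk' B)).IsComplement' H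
  · obtain ⟨H, hH⟩ := hsp
    obtain ⟨χ, hχ, hχA⟩ := split_to_hom hi H hH
    refine ⟨fun g => algebraMap (ZMod p) S (χ g), 0, ?_, ?_, ?_, fun _ => rfl,
      fun h => absurd ⟨H, hH⟩ h⟩
    · intro g h
      simp only
      rw [hχ, map_add]
      congr 1
      exact (ringAut_algebraMap (r g : S →+* S) _).symm
    · intro a ha; simp only; rw [hχA a ha]
    · intro g
      simp only
      rw [← map_pow, ZMod.pow_card]
      simp
  · -- general case
    have hinvr : ∀ y, ∀ a ∈ A, r (y * a) = r y := fun y a ha => by rw [map_mul, hr a ha, mul_one]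
    have hmulr : ∀ g h s, r (g * h) s = r g (r h s) := fun g h s => by rw [map_mul]; rfl
    let φ : G → ZMod p := fun g => i ((Quotient.out (QuotientGroup.mk g : G ⧸ A))⁻¹ * g)
    have hφ : ∀ g, ∀ a ∈ A, φ (g * a) = φ g + i a := by
      intro g a ha
      have e1 : (QuotientGroup.mk (g * a) : G ⧸ A) = QuotientGroup.mk g := by
        rw [QuotientGroup.eq]; simpa using ha
      have e2 : (Quotient.out (QuotientGroup.mk g : G ⧸ A))⁻¹ * g ∈ A := by
        rw [← QuotientGroup.eq, QuotientGroup.out_eq']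
      simp only [φ]
      rw [e1, ← mul_assoc, hi.mul _ e2 _ ha]
    let al := algebraMap (ZMod p) S
    let F : G → G → S := fun g y => al (φ y - φ (g⁻¹ * y)) * r y t
    have hF : ∀ g y, ∀ a ∈ A, F g (y * a) = F g y := by
      intro g y a ha
      simp only [F]
      rw [← mul_assoc, hφ _ a ha, hφ _ a ha, hinvr y a ha]
      congr 2; ring
    let f : G → S := fun g => cosetSum A (F g)
    have hf : ∀ g h, f (g * h) = f g + r g (f h) := by
      intro g h
      simp only [f]
      have e1 : r g (cosetSum A (F h)) = cosetSum A (fun y => r g (F h y)) :=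
        cosetSum_map (r g : S →+* S) _
      have e2 : ∀ y, r g (F h y) =
          (fun z => al (φ (g⁻¹ * z) - φ ((g * h)⁻¹ * z)) * r z t) (g * y) := by
        intro y
        simp only [F]
        rw [map_mul, hmulr, inv_mul_cancel_left, mul_inv_rev, mul_assoc h⁻¹, inv_mul_cancel_left]
        congr 1
        exact ringAut_algebraMap (r g : S →+* S) _
      rw [e1, cosetSum_translate (fun y => r g (F h y))
        (fun z => al (φ (g⁻¹ * z) - φ ((g * h)⁻¹ * z)) * r z t) g e2, ← cosetSum_add]
      · congr 1; funext y
        simp only [F]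
        rw [← add_mul, ← map_add]
        congr 2; ring
      · intro y a ha
        rw [← mul_assoc, ← mul_assoc, hφ _ a ha, hφ _ a ha, hinvr y a ha]
        congr 2; ring
    have hfA : ∀ a ∈ A, f a = al (i a) := by
      intro a ha
      have e1 : F a = fun y => al (i a) * r y t := by
        funext y
        have hm : y⁻¹ * a⁻¹ * y ∈ A := by
          simpa using Subgroup.Normal.conj_mem ‹A.Normal› _ (A.inv_mem ha) y⁻¹
        have e2 : a⁻¹ * y = y * (y⁻¹ * a⁻¹ * y) := by group
        simp only [F]
        rw [e2, hφ _ _ hm, hi.conj y _ (A.inv_mem ha), hi.inv a ha]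
        congr 2; ring
      simp only [f]
      rw [e1, cosetSum_mul, ht, mul_one]
    let P : G → S := fun g => f g ^ p - f g
    have hP : ∀ g h, P (g * h) = P g + r g (P h) := by
      intro g h
      simp only [P]
      rw [hf, add_pow_char, map_sub, map_pow]; ring
    have hPA : ∀ g, ∀ a ∈ A, P (g * a) = P g := by
      intro g a ha
      rw [hP]
      have : P a = 0 := by
        simp only [P]
        rw [hfA a ha, ← map_pow, ZMod.pow_card, sub_self]
      rw [this, map_zero, add_zero]
    let D : S := - cosetSum A (fun y => P y * r y t)
    have hD : ∀ g, P g = r g D - D := by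
      intro g
      have e1 : r g D = - cosetSum A (fun y => r g (P y * r y t)) := by
        simp only [D]; rw [map_neg]; congr 1
        exact cosetSum_map (r g : S →+* S) _
      have e2 : ∀ y, r g (P y * r y t) =
          (fun z => P z * r z t + (-P g) * r z t) (g * y) := by
        intro y
        simp only
        rw [hP, map_mul, hmulr]; ring
      rw [e1, cosetSum_translate _ (fun z => P z * r z t + (-P g) * r z t) g e2, cosetSum_add, cosetSum_mul, ht]
      · simp only [D]; ring
      · intro y a ha
        rw [hPA y a ha, hinvr y a ha]
    refine ⟨f, D, hf, hfA, hD, fun h => absurd h hsp, fun _ c hc => hsp ?_⟩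
    have hrD : ∀ g, r g D = D := fun g => by
      rw [hc]; exact ringAut_algebraMap (r g : S →+* S) _
    have hfc : ∀ g, ∃ c : ZMod p, f g = al c := by
      intro g
      apply exists_of_pow_eq
      have := hD g
      rw [hrD, sub_self] at this
      exact sub_eq_zero.1 this
    refine hom_to_split hAB hi f ?_ ?_ ?_
    · intro g h
      rw [hf]
      obtain ⟨c, hc⟩ := hfc h
      rw [hc]
      congr 1
      exact ringAut_algebraMap (r g : S →+* S) _
    · intro a ha h
      rw [hfA a ha] at h
      exact (map_eq_zero_iff al al.injective).1 h
    · intro g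
      obtain ⟨c, hc⟩ := hfc g
      obtain ⟨a, ha, hac⟩ := hi.surj c
      exact ⟨a, ha, by rw [hfA a ha, hc, hac]⟩

theorem sum_shift_pow {p : ℕ} [hp : Fact p.Prime] {T : Type*} [CommRing T] [Algebra (ZMod p) T]
    (Y : T) : ∑ c : ZMod p, (Y + algebraMap (ZMod p) T c) ^ (p - 1) = -1 := by
  classical
  have hlast : ∑ c : ZMod p, c ^ (p - 1) = -1 := by
    have h1 : ∀ c : ZMod p, c ^ (p - 1) = 1 - if c = 0 then 1 else 0 := by
      intro c
      split_ifs with h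
      · rw [h, zero_pow (Nat.sub_ne_zero_of_lt hp.out.one_lt), sub_self]
      · rw [ZMod.pow_card_sub_one_eq_one h, sub_zero]
    rw [Finset.sum_congr rfl (fun c _ => h1 c), Finset.sum_sub_distrib]
    simp
  have hsum : ∀ k ∈ Finset.range (p - 1 + 1),
      ∑ c : ZMod p, Y ^ k * (algebraMap (ZMod p) T c) ^ (p - 1 - k) * ((p - 1).choose k : T) =
      if k = 0 then -1 else 0 := by
    intro k hk
    rw [← Finset.sum_mul, ← Finset.mul_sum]
    simp_rw [← map_pow]
    rw [← map_sum]
    split_ifs with h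
    · subst h
      simp [hlast]
    · rw [FiniteField.sum_pow_lt_card_sub_one]
      · simp
      · rw [ZMod.card]
        have := hp.out.one_lt
        omega
  simp_rw [add_pow]
  rw [Finset.sum_comm, Finset.sum_congr rfl hsum]
  simp

theorem cosetSum_prod {G : Type*} [Group G] [Finite G] {p : ℕ} [Fact p.Prime]
    {A B : Subgroup G} (hAB : B ≤ A) {i : G → ZMod p} (hi : IsIota p A B i)
    {S : Type*} [AddCommMonoid S] (h : G → S) (hB : ∀ y, ∀ b ∈ B, h (y * b) = h y)
    (k : G → ZMod p → S) (hk : ∀ y, ∀ a ∈ A, h (y * a) = k y (i a)) :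
    cosetSum B h = cosetSum A (fun y => ∑ c : ZMod p, k y c) := by
  classical
  let _ := Fintype.ofFinite (G ⧸ A)
  let _ := Fintype.ofFinite (G ⧸ B)
  let _ := Fintype.ofFinite (A ⧸ B.subgroupOf A)
  unfold cosetSum
  have hbij : Function.Bijective
      (fun w : A ⧸ B.subgroupOf A => i (Quotient.out w : A)) := by
    constructor
    · intro w w' hw
      simp only at hw
      rw [← QuotientGroup.out_eq' w, ← QuotientGroup.out_eq' w', QuotientGroup.eq,
        Subgroup.mem_subgroupOf]
      push_cast
      rw [← hi.ker _ (A.mul_mem (A.inv_mem (Quotient.out w).2) (Quotient.out w').2),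
        hi.mul _ (A.inv_mem (Quotient.out w).2) _ (Quotient.out w').2,
        hi.inv _ (Quotient.out w).2, hw]
      ring
    · intro c
      obtain ⟨a, ha, hac⟩ := hi.surj c
      refine ⟨QuotientGroup.mk ⟨a, ha⟩, ?_⟩
      simp only
      rw [← hac]
      have h1 : (QuotientGroup.mk (Quotient.out (QuotientGroup.mk ⟨a, ha⟩ :
        A ⧸ B.subgroupOf A)) : A ⧸ B.subgroupOf A) = QuotientGroup.mk ⟨a, ha⟩ :=
        QuotientGroup.out_eq' _
      set v := (Quotient.out (QuotientGroup.mk ⟨a, ha⟩ : A ⧸ B.subgroupOf A)) with hv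
      rw [QuotientGroup.eq, Subgroup.mem_subgroupOf] at h1
      push_cast at h1
      rw [← hi.ker _ (A.mul_mem (A.inv_mem v.2) ha),
        hi.mul _ (A.inv_mem v.2) _ ha, hi.inv _ v.2] at h1
      linear_combination -h1
  rw [← Equiv.sum_comp (Subgroup.quotientEquivProdOfLE hAB).symm, Fintype.sum_prod_type]
  refine Finset.sum_congr rfl fun z _ => ?_
  change _ = ∑ c, k (Quotient.out z) c
  rw [← Equiv.sum_comp (Equiv.ofBijective _ hbij) (fun c => k (Quotient.out z) c)]
  refine Finset.sum_congr rfl fun w _ => ?_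
  have e1 : (Subgroup.quotientEquivProdOfLE hAB).symm (z, w) =
      QuotientGroup.mk (Quotient.out z * (Quotient.out w : A)) := by
    conv_lhs => rw [← QuotientGroup.out_eq' w]
    rfl
  rw [e1, cosetSum_out h hB, hk _ _ (Quotient.out w).2]
  rfl

section poly
open Polynomial

/-- twisted shift -/
noncomputable def shiftHom {S : Type*} [CommRing S] (e : S →+* S) (b : S) : S[X] →+* S[X] :=
  (compRingHom (Polynomial.X + Polynomial.C b)).comp (mapRingHom e)

theorem shiftHom_C {S : Type*} [CommRing S] (e : S →+* S) (b s : S) :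
    shiftHom e b (Polynomial.C s) = Polynomial.C (e s) := by simp [shiftHom]

theorem shiftHom_X {S : Type*} [CommRing S] (e : S →+* S) (b : S) :
    shiftHom e b Polynomial.X = Polynomial.X + Polynomial.C b := by simp [shiftHom]

theorem shiftHom_natDegree {S : Type*} [CommRing S] [IsDomain S] (e : S →+* S) (b : S) (q : S[X]) :
    (shiftHom e b q).natDegree ≤ q.natDegree := by
  simp only [shiftHom, RingHom.comp_apply, coe_compRingHom_apply, coe_mapRingHom]
  rw [natDegree_comp, natDegree_X_add_C, mul_one]
  exact natDegree_map_le

theorem shiftHom_comp {S : Type*} [CommRing S] (e e' : S →+* S) (b b' : S) (q : S[X]) :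
    shiftHom e b (shiftHom e' b' q) = shiftHom (e.comp e') (b + e b') q := by
  have : (shiftHom e b).comp (shiftHom e' b') = shiftHom (e.comp e') (b + e b') := by
    apply Polynomial.ringHom_ext
    · intro a; simp [shiftHom_C]
    · simp [shiftHom_C, shiftHom_X]; ring
  exact RingHom.congr_fun this q

theorem shiftHom_id {S : Type*} [CommRing S] : shiftHom (RingHom.id S) 0 = RingHom.id S[X] := by
  apply Polynomial.ringHom_ext
  · intro a; simp [shiftHom_C]
  · simp [shiftHom_X]

theorem exists_action {G : Type*} [Group G] {S : Type*} [CommRing S]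
    (r : G →* RingAut S) (f : G → S) (hf : ∀ g h, f (g * h) = f g + r g (f h)) :
    ∃ R : G →* RingAut S[X], ∀ g q, R g q = shiftHom (r g : S →+* S) (f g) q := by
  have h1 : f 1 = 0 := by
    have := hf 1 1
    rw [mul_one, map_one] at this
    simpa using this
  have hone : shiftHom (r 1 : S →+* S) (f 1) = RingHom.id S[X] := by
    rw [h1, map_one, ← shiftHom_id]; rfl
  have hmul : ∀ g h, (shiftHom (r g : S →+* S) (f g)).comp (shiftHom (r h : S →+* S) (f h)) =
      shiftHom (r (g * h) : S →+* S) (f (g * h)) := by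
    intro g h
    apply Polynomial.ringHom_ext
    · intro a; simp [shiftHom_C]
    · simp [shiftHom_C, shiftHom_X, hf]; ring
  let R0 : G → RingAut S[X] := fun g => RingEquiv.ofRingHom
    (shiftHom (r g : S →+* S) (f g)) (shiftHom (r g⁻¹ : S →+* S) (f g⁻¹))
    (by rw [hmul, mul_inv_cancel, hone]) (by rw [hmul, inv_mul_cancel, hone])
  refine ⟨MonoidHom.mk' R0 ?_, fun g q => rfl⟩
  intro g h
  ext1 q
  exact (RingHom.congr_fun (hmul g h) q).symm

theorem const_of_shift {p : ℕ} [hp : Fact p.Prime] {S : Type*} [CommRing S] [IsDomain S]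
    [Algebra (ZMod p) S] (q : S[X]) (hq : q.natDegree < p)
    (h : ∀ c : ZMod p, q.eval (algebraMap (ZMod p) S c) = q.eval 0) : q = Polynomial.C (q.eval 0) := by
  have := Polynomial.eq_zero_of_natDegree_lt_card_of_eval_eq_zero (q - Polynomial.C (q.eval 0))
    (f := fun c : ZMod p => algebraMap (ZMod p) S c) (algebraMap (ZMod p) S).injective
    (by intro c; simp [h c]) (by rw [natDegree_sub_C, ZMod.card]; exact hq)
  exact sub_eq_zero.1 this

theorem poly_step {G : Type*} [Group G] [Finite G] {p : ℕ} [hp : Fact p.Prime]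
    {A B : Subgroup G} (hAB : B ≤ A)
    {i : G → ZMod p} (hi : IsIota p A B i)
    {S : Type*} [CommRing S] [IsDomain S] [Algebra (ZMod p) S]
    (r : G →* RingAut S) (hr : ∀ a ∈ A, r a = 1) (t : S)
    (ht : cosetSum A (fun y => r y t) = 1)
    (hgal : ∀ I : Ideal S, I ≠ ⊤ → ∀ g, g ∉ A → ∃ s, r g s - s ∉ I)
    (f : G → S) (D : S) (hf : ∀ g h, f (g * h) = f g + r g (f h))
    (hfA : ∀ a ∈ A, f a = algebraMap (ZMod p) S (i a))
    (hD : ∀ g, f g ^ p - f g = r g D - D) :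
    ∃ R : G →* RingAut S[X],
      (∀ b ∈ B, R b = 1) ∧
      (∀ g s, R g (Polynomial.C s) = Polynomial.C (r g s)) ∧
      (∃ t', cosetSum B (fun y => R y t') = 1) ∧
      (∀ I : Ideal S[X], I ≠ ⊤ → ∀ g, g ∉ B → ∃ s, R g s - s ∉ I) ∧
      (∀ g, R g (Polynomial.X ^ p - Polynomial.X - Polynomial.C D) = Polynomial.X ^ p - Polynomial.X - Polynomial.C D) ∧
      (∀ K : Subring S[X], Polynomial.X ^ p - Polynomial.X - Polynomial.C D ∈ K → (∀ s, (∀ g, r g s = s) → Polynomial.C s ∈ K) →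
        ∀ q, (∀ g, R g q = q) → q ∈ K) := by
  classical
  have hchar : CharP S p := charP_of_injective_algebraMap (algebraMap (ZMod p) S).injective p
  have hcharX : CharP S[X] p := inferInstance
  obtain ⟨R, hR⟩ := exists_action r f hf
  have hRC : ∀ g s, R g (Polynomial.C s) = Polynomial.C (r g s) := fun g s => by rw [hR, shiftHom_C]; rfl
  have hRX : ∀ g, R g Polynomial.X = Polynomial.X + Polynomial.C (f g) := fun g => by rw [hR, shiftHom_X]
  have hRmul : ∀ g h s, R (g * h) s = R g (R h s) := fun g h s => by rw [map_mul]; rfl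
  have hRB : ∀ b ∈ B, R b = 1 := by
    intro b hb
    ext1 q
    rw [hR, hr b (hAB hb), hfA b (hAB hb), (hi.ker b (hAB hb)).2 hb, map_zero]
    exact RingHom.congr_fun shiftHom_id q
  have hRP : ∀ g, R g (Polynomial.X ^ p - Polynomial.X - Polynomial.C D) = Polynomial.X ^ p - Polynomial.X - Polynomial.C D := by
    intro g
    rw [map_sub, map_sub, map_pow, hRX, hRC, add_pow_char]
    have := congrArg Polynomial.C (hD g)
    simp only [map_sub, map_pow] at this
    linear_combination this
  refine ⟨R, hRB, hRC, ?_, ?_, hRP, ?_⟩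
  · refine ⟨-(Polynomial.C t * Polynomial.X ^ (p - 1)), ?_⟩
    rw [cosetSum_prod hAB hi _ _
      (fun y c => R y (-(Polynomial.C t * (Polynomial.X + algebraMap (ZMod p) S[X] c) ^ (p - 1))))]
    · have e1 : ∀ y, ∑ c : ZMod p, R y (-(Polynomial.C t * (Polynomial.X + algebraMap (ZMod p) S[X] c) ^ (p - 1))) =
        (Polynomial.C : S →+* S[X]) (r y t) := by
        intro y
        rw [← map_sum, Finset.sum_neg_distrib, ← Finset.mul_sum, sum_shift_pow, ← hRC]
        congr 1; ring
      simp_rw [e1]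
      rw [← cosetSum_map (Polynomial.C : S →+* S[X]), ht, map_one]
    · intro y a ha
      rw [hRmul]
      congr 1
      rw [map_neg, map_mul, map_pow, hRX, hRC, hr a ha, hfA a ha]
      rfl
    · intro y b hb
      rw [map_mul, hRB b hb, mul_one]
  · intro I hI g hg
    by_cases hgA : g ∈ A
    · refine ⟨Polynomial.X, fun hmem => hI ?_⟩
      rw [hRX, add_sub_cancel_left, hfA g hgA] at hmem
      have hne : i g ≠ 0 := fun h => hg ((hi.ker g hgA).1 h)
      apply Ideal.eq_top_of_isUnit_mem _ hmem
      exact ((isUnit_iff_ne_zero.2 hne).map (algebraMap (ZMod p) S)).map Polynomial.C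
    · obtain ⟨s, hs⟩ := hgal (I.comap Polynomial.C) (Ideal.comap_ne_top _ hI) g hgA
      refine ⟨Polynomial.C s, fun hmem => hs ?_⟩
      rw [Ideal.mem_comap, map_sub, ← hRC]
      exact hmem
  · intro K hPK hCK
    set P : S[X] := Polynomial.X ^ p - Polynomial.X - Polynomial.C D with hPdef
    have hPX : P = Polynomial.X ^ p - (Polynomial.X + Polynomial.C D) := by rw [hPdef]; ring
    have hp1 := hp.out.one_lt
    have hdl : (Polynomial.X + Polynomial.C D : S[X]).degree < (p : WithBot ℕ) := by
      rw [degree_X_add_C]; exact_mod_cast hp1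
    have hPm : P.Monic := by
      rw [hPX]; exact monic_X_pow_sub hdl
    have hPd : P.natDegree = p := by
      rw [hPX, natDegree_sub_eq_left_of_natDegree_lt, natDegree_X_pow]
      rw [natDegree_X_add_C, natDegree_X_pow]; exact hp1
    have hP1 : P ≠ 1 := by
      intro h; rw [h, natDegree_one] at hPd; omega
    have main : ∀ N : ℕ, ∀ q : S[X], q.natDegree ≤ N → (∀ g, R g q = q) → q ∈ K := by
      intro N
      induction N using Nat.strong_induction_on with
      | _ N ih =>
      intro q hqN hq
      have hfix : ∀ g, q /ₘ P = R g (q /ₘ P) ∧ q %ₘ P = R g (q %ₘ P) := by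
        intro g
        apply div_modByMonic_unique _ _ hPm
        constructor
        · have := congrArg (R g) (modByMonic_add_div q P)
          rw [map_add, map_mul, hRP, hq] at this
          exact this
        · apply degree_lt_degree
          rw [hR]
          exact (shiftHom_natDegree _ _ _).trans_lt (natDegree_modByMonic_lt q hPm hP1)
      have hrem : q %ₘ P = Polynomial.C ((q %ₘ P).eval 0) := by
        apply const_of_shift (p := p)
        · rw [← hPd]; exact natDegree_modByMonic_lt q hPm hP1
        · intro c
          obtain ⟨a, ha, rfl⟩ := hi.surj c
          conv_rhs => rw [(hfix a).2, hR, hr a ha, hfA a ha]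
          have : (((1 : RingAut S) : S ≃+* S) : S →+* S) = RingHom.id S := rfl
          simp [shiftHom, this]
      rw [← modByMonic_add_div q P]
      refine K.add_mem ?_ (K.mul_mem hPK ?_)
      · rw [hrem]
        apply hCK
        intro g
        apply Polynomial.C_injective
        rw [← hRC, ← hrem, ← (hfix g).2]
      · by_cases hq0 : q.natDegree < p
        · rw [(divByMonic_eq_zero_iff hPm).2 (degree_lt_degree (by rw [hPd]; exact hq0))]
          exact K.zero_mem
        · apply ih (q.natDegree - p) (by omega) _ _ (fun g => (hfix g).1.symm)
          rw [natDegree_divByMonic q hPm, hPd]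
    exact fun q hq => main _ q le_rfl hq
end poly

theorem exists_mvEquiv (p m : ℕ) :
    ∃ e : MvPolynomial (Fin (m + 1)) (ZMod p) ≃+* Polynomial (MvPolynomial (Fin m) (ZMod p)),
      (∀ q, e (rename Fin.castSucc q) = Polynomial.C q) ∧ e (X (Fin.last m)) = Polynomial.X := by
  let e : MvPolynomial (Fin (m + 1)) (ZMod p) ≃ₐ[ZMod p]
      Polynomial (MvPolynomial (Fin m) (ZMod p)) :=
    (renameEquiv (ZMod p) finSuccEquivLast).trans (optionEquivLeft (ZMod p) (Fin m))
  refine ⟨e.toRingEquiv, ?_, ?_⟩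
  · intro q
    have : e.toAlgHom.comp (rename Fin.castSucc) =
        (Polynomial.CAlgHom : _ →ₐ[MvPolynomial (Fin m) (ZMod p)] _).restrictScalars (ZMod p) := by
      apply MvPolynomial.algHom_ext
      intro j
      simp [e]
    exact AlgHom.congr_fun this q
  · change e (X (Fin.last m)) = _
    simp [e]

/-- One stage of the tower. -/
structure Stage {G : Type*} [Group G] [Finite G] (p n : ℕ) (Gser : ℕ → Subgroup G) (m : ℕ) where
  r : G →* RingAut (MvPolynomial (Fin m) (ZMod p))
  ker : ∀ a ∈ Gser m, r a = 1
  good : m ≤ n → (∃ t, cosetSum (Gser m) (fun y => r y t) = 1) ∧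
    ∀ I : Ideal (MvPolynomial (Fin m) (ZMod p)), I ≠ ⊤ → ∀ g, g ∉ Gser m → ∃ s, r g s - s ∉ I

theorem Stage.next {G : Type*} [Group G] [Finite G] {p n : ℕ} [hp : Fact p.Prime]
    (hG : Nat.card G = p ^ n)
    (Gser : ℕ → Subgroup G) [∀ j, (Gser j).Normal]
    (hlt : ∀ j, j < n → Gser (j + 1) < Gser j)
    (hcard : ∀ j, j ≤ n → Nat.card (Gser j) = p ^ (n - j)) (m : ℕ) (s : Stage p n Gser m) :
    ∃ (D : MvPolynomial (Fin m) (ZMod p)) (s' : Stage p n Gser (m + 1)), m < n →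
      (splitAt Gser (m + 1) → D = 0) ∧
      (¬ splitAt Gser (m + 1) → ∀ c : ZMod p, D ≠ C c) ∧
      (∀ g q, s'.r g (rename Fin.castSucc q) = rename Fin.castSucc (s.r g q)) ∧
      (∀ g, s'.r g (X (Fin.last m) ^ p - X (Fin.last m) - rename Fin.castSucc D) =
        X (Fin.last m) ^ p - X (Fin.last m) - rename Fin.castSucc D) ∧
      (∀ K : Subring (MvPolynomial (Fin (m + 1)) (ZMod p)),
        X (Fin.last m) ^ p - X (Fin.last m) - rename Fin.castSucc D ∈ K →
        (∀ q, (∀ g, s.r g q = q) → rename Fin.castSucc q ∈ K) →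
        ∀ q, (∀ g, s'.r g q = q) → q ∈ K) := by
  classical
  by_cases hm : m < n
  swap
  · exact ⟨0, ⟨1, fun _ _ => rfl, fun h => absurd h (by omega)⟩, fun h => absurd h hm⟩
  have hAB : Gser (m + 1) ≤ Gser m := (hlt m hm).le
  obtain ⟨i, hi⟩ := exists_iota hG (Gser m) (Gser (m + 1)) hAB
    (by rw [hcard m hm.le, hcard (m + 1) hm, ← pow_succ']; congr 1; omega)
    (by rw [hcard (m + 1) hm]; exact pow_ne_zero _ hp.out.ne_zero)
  obtain ⟨⟨t, ht⟩, hgal⟩ := s.good hm.le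
  obtain ⟨f, D, hf, hfA, hD, hs1, hs2⟩ := cocycle_step hAB hi s.r s.ker t ht
  obtain ⟨R, hRB, hRC, ⟨t', ht'⟩, hRgal, hRP, hRK⟩ :=
    poly_step hAB hi s.r s.ker t ht hgal f D hf hfA hD
  obtain ⟨e, heC, heX⟩ := exists_mvEquiv p m
  let R' : G →* RingAut (MvPolynomial (Fin (m + 1)) (ZMod p)) := MonoidHom.mk'
    (fun g => (e.trans (R g)).trans e.symm) (fun g h => by
      ext1 q
      rw [map_mul]
      change e.symm (R g (R h (e q))) = e.symm (R g (e (e.symm (R h (e q)))))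
      rw [e.apply_symm_apply])
  have hR' : ∀ g q, R' g q = e.symm (R g (e q)) := fun g q => rfl
  have heP : e (X (Fin.last m) ^ p - X (Fin.last m) - rename Fin.castSucc D) =
      Polynomial.X ^ p - Polynomial.X - Polynomial.C D := by
    rw [map_sub, map_sub, map_pow, heX, heC]
  refine ⟨D, ⟨R', ?_, fun _ => ⟨⟨e.symm t', ?_⟩, ?_⟩⟩, fun _ => ⟨hs1, hs2, ?_, ?_, ?_⟩⟩
  · intro a ha
    ext1 q
    rw [hR', hRB a ha]
    exact e.symm_apply_apply q
  · have : ∀ y, R' y (e.symm t') = (e.symm : _ →+* _) (R y t') := fun y => by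
      rw [hR', e.apply_symm_apply]; rfl
    simp_rw [this]
    rw [← cosetSum_map, ht', map_one]
  · intro I hI g hg
    obtain ⟨s0, hs0⟩ := hRgal (I.comap (e.symm : _ →+* _)) (Ideal.comap_ne_top _ hI) g hg
    refine ⟨e.symm s0, fun hmem => hs0 ?_⟩
    rw [hR', e.apply_symm_apply, ← map_sub] at hmem
    exact hmem
  · intro g q
    change R' g _ = _
    rw [hR', heC, hRC, ← heC, e.symm_apply_apply]
  · intro g
    change R' g _ = _
    rw [hR', heP, hRP, ← heP, e.symm_apply_apply]
  · intro K hK1 hK2 q hq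
    have := hRK (K.comap (e.symm : _ →+* _)) ?_ ?_ (e q) ?_
    · rw [Subring.mem_comap] at this
      simpa using this
    · rw [Subring.mem_comap, ← heP]
      simpa using hK1
    · intro s0 hs0
      rw [Subring.mem_comap, ← heC]
      simpa using hK2 s0 hs0
    · intro g
      have h1 : R' g q = q := hq g
      rw [hR'] at h1
      rw [e.symm_apply_eq] at h1
      exact h1

theorem generic_extension_exists (p n : ℕ) (hp : p.Prime)
    (G : Type*) [Group G] [Finite G] (hG : Nat.card G = p ^ n)
    (Gser : ℕ → Subgroup G) [∀ j, (Gser j).Normal]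
    (htop : Gser 0 = ⊤) (hbot : Gser n = ⊥)
    (hlt : ∀ j, j < n → Gser (j + 1) < Gser j)
    (hcard : ∀ j, j ≤ n → Nat.card (Gser j) = p ^ (n - j)) :
    ∃ D : (j : ℕ) → MvPolynomial (Fin (j - 1)) (ZMod p),
      -- (a)
      (∀ i, 1 ≤ i → i ≤ n →
        (splitAt Gser i → D i = 0) ∧
        (¬ splitAt Gser i → ∀ c : ZMod p, D i ≠ C c)) ∧
      -- (b), (c): a compatible family of actions of G/G_(i) on S_i realizing each
      -- S_i/R_i as a Galois extension of rings with group G/G_(i)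
      ∃ ρ : (i : ℕ) → (G ⧸ Gser i) →* RingAut (MvPolynomial (Fin i) (ZMod p)),
        ∀ i, 1 ≤ i → i ≤ n →
          Function.Injective (ρ i) ∧
          -- the fixed ring of the action is R_i = F_p[X_1,...,X_i]
          (∀ q : MvPolynomial (Fin i) (ZMod p),
            (∀ g : G ⧸ Gser i, ρ i g q = q) ↔
              q ∈ Algebra.adjoin (ZMod p) (XeltSet p D i)) ∧
          -- the Galois condition for S_i/R_i
          (∀ M : Ideal (MvPolynomial (Fin i) (ZMod p)), M.IsMaximal →
            ∀ g : G ⧸ Gser i, g ≠ 1 →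
              ∃ s : MvPolynomial (Fin i) (ZMod p), ρ i g s - s ∉ M) ∧
          -- compatibility with restriction and the projection G/G_(i) → G/G_(i-1)
          (∀ g : G, ∀ q : MvPolynomial (Fin (i - 1)) (ZMod p),
            ρ i (QuotientGroup.mk g) (rename (Fin.castLE (Nat.sub_le i 1)) q) =
              rename (Fin.castLE (Nat.sub_le i 1))
                (ρ (i - 1) (QuotientGroup.mk g) q)) := by
    classical
  have : Fact p.Prime := ⟨hp⟩
  have s0 : Stage p n Gser 0 := ⟨1, fun _ _ => rfl, fun _ => ⟨⟨1, by
    unfold cosetSum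
    let _ := Fintype.ofFinite (G ⧸ Gser 0)
    have hc : Fintype.card (G ⧸ Gser 0) = 1 := by
      rw [← Nat.card_eq_fintype_card, ← Subgroup.index_eq_card, htop, Subgroup.index_top]
    simp only [map_one, Finset.sum_const, Finset.card_univ, hc, one_smul]⟩,
    fun I _ g hg => absurd (by rw [htop]; trivial) hg⟩⟩
  choose Dn nxt hn using Stage.next hG Gser hlt hcard
  let sq : (m : ℕ) → Stage p n Gser m := fun m => Nat.rec s0 (fun m s => nxt m s) m
  have hsq : ∀ m, sq (m + 1) = nxt m (sq m) := fun m => rfl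
  let D : (j : ℕ) → MvPolynomial (Fin (j - 1)) (ZMod p) := fun j => Dn (j - 1) (sq (j - 1))
  have hDX : ∀ m (h : m + 1 - 1 < m + 1), Xelt p D (m + 1) (m + 1) h =
    X (Fin.last m) ^ p - X (Fin.last m) - rename Fin.castSucc (Dn m (sq m)) := fun m h => rfl
  have hXs : ∀ i j (h : j - 1 < i) (h' : j - 1 < i + 1), Xelt p D (i + 1) j h' =
      rename Fin.castSucc (Xelt p D i j h) := by
    intro i j h h'
    simp only [Xelt, map_sub, map_pow, rename_X, rename_rename]
    rfl
  have hfix : ∀ m, m ≤ n → ∀ q : MvPolynomial (Fin m) (ZMod p), (∀ g, (sq m).r g q = q) ↔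
      q ∈ Algebra.adjoin (ZMod p) (XeltSet p D m) := by
    intro m
    induction m with
    | zero =>
      intro _ q
      have hq : q ∈ (⊥ : Subalgebra (ZMod p) (MvPolynomial (Fin 0) (ZMod p))) := by
        rw [Algebra.mem_bot]
        exact ⟨_, (eq_C_of_isEmpty q).symm⟩
      refine ⟨fun _ => (bot_le : (⊥ : Subalgebra _ _) ≤ _) hq, fun _ g => ?_⟩
      obtain ⟨c, rfl⟩ := Algebra.mem_bot.1 hq
      exact ringAut_algebraMap (RingEquiv.toRingHom ((sq 0).r g)) c
    | succ m ih =>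
      intro hm q
      have ih := ih (by omega)
      obtain ⟨-, -, hcomp, hXfix, hgen⟩ := hn m (sq m) (by omega)
      rw [← hsq] at hcomp hXfix hgen
      have hsub : ∀ q ∈ XeltSet p D m, rename Fin.castSucc q ∈ XeltSet p D (m + 1) := by
        rintro q ⟨j, h1, h2, rfl⟩
        exact ⟨j, h1, by omega, (hXs _ _ _ _).symm⟩
      constructor
      · intro hq
        refine hgen (Algebra.adjoin (ZMod p) (XeltSet p D (m + 1))).toSubring ?_ ?_ q hq
        · exact Algebra.subset_adjoin ⟨m + 1, by omega, le_rfl, (hDX m _).symm⟩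
        · intro q0 hq0
          have h1 := (ih q0).1 hq0
          have h2 : Algebra.adjoin (ZMod p) (XeltSet p D m) ≤
              (Algebra.adjoin (ZMod p) (XeltSet p D (m + 1))).comap (rename Fin.castSucc) := by
            rw [Algebra.adjoin_le_iff]
            intro x hx
            exact Algebra.subset_adjoin (hsub x hx)
          exact h2 h1
      · intro hq g
        induction hq using Algebra.adjoin_induction with
        | mem x hx =>
          obtain ⟨j, h1, h2, rfl⟩ := hx
          rcases Nat.lt_or_ge m j with h | h
          · obtain rfl : j = m + 1 := by omega
            rw [hDX]
            exact hXfix g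
          · rw [hXs m j (by omega), hcomp]
            congr 1
            exact (ih _).2 (Algebra.subset_adjoin ⟨j, h1, h, rfl⟩) g
        | algebraMap c => exact ringAut_algebraMap (RingEquiv.toRingHom ((sq (m + 1)).r g)) c
        | add x y _ _ hx hy => rw [map_add, hx, hy]
        | mul x y _ _ hx hy => rw [map_mul, hx, hy]
  refine ⟨D, ?_, fun i => QuotientGroup.lift (Gser i) (sq i).r (fun a ha => (sq i).ker a ha), ?_⟩
  · intro i h1 h2
    obtain ⟨m, rfl⟩ : ∃ m, i = m + 1 := ⟨i - 1, by omega⟩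
    obtain ⟨ha, hb, -⟩ := hn m (sq m) (by omega)
    exact ⟨ha, hb⟩
  · intro i h1 h2
    have hgal : ∀ M : Ideal (MvPolynomial (Fin i) (ZMod p)), M ≠ ⊤ →
            ∀ g : G ⧸ Gser i, g ≠ 1 →
              ∃ s : MvPolynomial (Fin i) (ZMod p),
                QuotientGroup.lift (Gser i) (sq i).r (fun a ha => (sq i).ker a ha) g s - s ∉ M := by
      intro M hM g hg
      obtain ⟨g, rfl⟩ := QuotientGroup.mk_surjective g
      exact ((sq i).good h2).2 M hM g (fun h => hg ((QuotientGroup.eq_one_iff g).2 h))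
    refine ⟨?_, ?_, fun M hM => hgal M hM.ne_top, ?_⟩
    · rw [injective_iff_map_eq_one]
      intro g hg
      by_contra hne
      obtain ⟨s, hs⟩ := hgal ⊥ bot_ne_top g hne
      apply hs
      rw [hg]
      simp
    · intro q
      rw [← hfix i h2 q]
      constructor
      · intro h g
        exact h (QuotientGroup.mk g)
      · intro h g
        obtain ⟨g, rfl⟩ := QuotientGroup.mk_surjective g
        exact h g
    · obtain ⟨m, rfl⟩ : ∃ m, i = m + 1 := ⟨i - 1, by omega⟩
      obtain ⟨-, -, hcomp, -⟩ := hn m (sq m) (by omega)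
      intro g q
      exact hcomp g q
end

section
/- Let (G, {G_(i)}) be a p-filtered group of order p^n with r = rank(G), and let D_i ∈ F_p[Y_1,...,Y_{i-1}] (1 ≤ i ≤ n) be polynomials satisfying the conditions of the generic construction. Let F be a field of characteristic p with dim_{F_p}(F/℘(F)) ≥ r, and let a_1,...,a_n ∈ F be such that {a_j + ℘(F) : j ∈ Σ_G} is an F_p-linearly independent subset of F/℘(F). Define F_0 = F and F_i = F_{i-1}(α_i) for 1 ≤ i ≤ n, where α_i ∈ F^sep satisfies α_i^p − α_i = d_i + a_i with d_i = D_i(α_1,...,α_{i-1}). Then for 0 ≤ i ≤ n, F_i/F is a Galois field extension and there are isomorphisms μ_i : Gal(F_i/F) → G/G_(i) which, for each 1 ≤ i ≤ n, are compatible with the restriction map Gal(F_i/F) → Gal(F_{i-1}/F) and the canonical projection G/G_(i) → G/G_(i-1). -/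
/-!
STATEMENT 8 (Theorem 3.6(a) of the paper):
Let (G, {G_(i)}) be a p-filtered group of order p^n with r = rank(G), and let
D_i ∈ F_p[Y_1,...,Y_{i-1}] be polynomials satisfying the conditions of the generic
construction.  Let F be a field of characteristic p with dim_{F_p}(F/℘(F)) ≥ r, and let
a_1,...,a_n ∈ F be such that {a_j + ℘(F) : j ∈ Σ_G} is F_p-linearly independent in
F/℘(F)).  Define F_0 = F and F_i = F_{i-1}(α_i), where α_i ∈ F^sep satisfies
α_i^p − α_i = d_i + a_i with d_i = D_i(α_1,...,α_{i-1}).  Then each F_i/F is a Galois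
field extension and there are isomorphisms μ_i : Gal(F_i/F) ≅ G/G_(i) compatible with
restriction and the canonical projections G/G_(i) → G/G_(i-1).
-/

open MvPolynomial

/-- The family D_1, ..., D_n satisfies the conditions of Saltman's generic construction
(Proposition 3.5 of the paper). -/
def IsSaltmanFamily (p n : ℕ) (G : Type*) [Group G]
    (Gser : ℕ → Subgroup G) [∀ j, (Gser j).Normal]
    (D : (j : ℕ) → MvPolynomial (Fin (j - 1)) (ZMod p)) : Prop :=
  (∀ i, 1 ≤ i → i ≤ n →
    (splitAt Gser i → D i = 0) ∧
    (¬ splitAt Gser i → ∀ c : ZMod p, D i ≠ C c)) ∧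
  ∃ ρ : (i : ℕ) → (G ⧸ Gser i) →* RingAut (MvPolynomial (Fin i) (ZMod p)),
    ∀ i, 1 ≤ i → i ≤ n →
      Function.Injective (ρ i) ∧
      (∀ q : MvPolynomial (Fin i) (ZMod p),
        (∀ g : G ⧸ Gser i, ρ i g q = q) ↔
          q ∈ Algebra.adjoin (ZMod p) (XeltSet p D i)) ∧
      (∀ M : Ideal (MvPolynomial (Fin i) (ZMod p)), M.IsMaximal →
        ∀ g : G ⧸ Gser i, g ≠ 1 →
          ∃ s : MvPolynomial (Fin i) (ZMod p), ρ i g s - s ∉ M) ∧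
      (∀ g : G, ∀ q : MvPolynomial (Fin (i - 1)) (ZMod p),
        ρ i (QuotientGroup.mk g) (rename (Fin.castLE (Nat.sub_le i 1)) q) =
          rename (Fin.castLE (Nat.sub_le i 1)) (ρ (i - 1) (QuotientGroup.mk g) q))

/-- The set {α_1, ..., α_i} generating the i-th field of the tower. -/
def towerSet {Ω : Type*} (α : ℕ → Ω) (i : ℕ) : Set Ω :=
  {x | ∃ j, 1 ≤ j ∧ j ≤ i ∧ x = α j}

lemma towerSet_mono {Ω : Type*} (α : ℕ → Ω) {i k : ℕ} (h : i ≤ k) :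
    towerSet α i ⊆ towerSet α k := by
  rintro x ⟨j, h1, h2, rfl⟩; exact ⟨j, h1, le_trans h2 h, rfl⟩

/-- The tower F_i = F(α_1, ..., α_i) inside a fixed algebraic closure. -/
noncomputable def towerField (F : Type*) [Field F] (α : ℕ → AlgebraicClosure F)
    (i : ℕ) : IntermediateField F (AlgebraicClosure F) :=
  IntermediateField.adjoin F (towerSet α i)

lemma towerField_mono (F : Type*) [Field F] (α : ℕ → AlgebraicClosure F) {i k : ℕ}
    (h : i ≤ k) : towerField F α i ≤ towerField F α k :=
  IntermediateField.adjoin.mono _ _ _ (towerSet_mono α h)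


set_option linter.unusedSectionVars false

/-! ### Artin–Schreier roots -/

lemma gsg_root {p : ℕ} [Fact p.Prime] {R : Type*} [CommRing R] [IsDomain R] [CharP R p]
    (f : ZMod p →+* R) {x y : R} (h : x ^ p - x = y ^ p - y) : ∃ c : ZMod p, x = y + f c := by
  have h1 : (x - y) ^ p - (x - y) = 0 := by
    rw [sub_pow_char]; linear_combination h
  have h2 : ∏ c : ZMod p, ((x - y) - f c) = (x - y) ^ p - (x - y) := by
    have hd := FiniteField.X_pow_card_sub_X_natDegree_eq (ZMod p) (p := p) (Fact.out : p.Prime).one_lt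
    have hr : (Polynomial.X ^ p - Polynomial.X : Polynomial (ZMod p)).roots =
        Finset.univ.val := by
      have := FiniteField.roots_X_pow_card_sub_X (ZMod p)
      rwa [ZMod.card] at this
    have h3 : (∏ c : ZMod p, (Polynomial.X - Polynomial.C c)) = Polynomial.X ^ p - Polynomial.X := by
      have := Polynomial.prod_multiset_X_sub_C_of_monic_of_roots_card_eq
        (p := (Polynomial.X ^ p - Polynomial.X : Polynomial (ZMod p)))
        (Polynomial.monic_X_pow_sub (by
          rw [Polynomial.degree_X]; exact_mod_cast (Fact.out : p.Prime).one_lt)) (by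
          rw [hd, hr]; simp [ZMod.card])
      rw [hr] at this
      exact this
    have h4 := congrArg (Polynomial.eval₂ f (x - y)) h3
    simpa [Polynomial.eval₂_finsetProd] using h4
  rw [h1, Finset.prod_eq_zero_iff] at h2
  obtain ⟨c, -, hc⟩ := h2
  exact ⟨c, by linear_combination hc⟩

lemma gsg_frob {p : ℕ} [Fact p.Prime] {R : Type*} [CommRing R] 
    (f : ZMod p →+* R) (c : ZMod p) : f c ^ p = f c := by
  rw [← map_pow, ZMod.pow_card]

/-! ### Group theory of the filtration -/

structure GFilt (p n : ℕ) {G : Type*} [Group G] (Gs : ℕ → Subgroup G) : Prop where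
  anti : ∀ j, j < n → Gs (j + 1) < Gs j
  card : ∀ j, j ≤ n → Nat.card (Gs j) = p ^ (n - j)

lemma GFilt.mid {p n : ℕ} [hp : Fact p.Prime] {G : Type*} [Group G] [Finite G]
    {Gs : ℕ → Subgroup G}
    (h : GFilt p n Gs) {i : ℕ} (hi : i < n) (K : Subgroup G) (h1 : Gs (i + 1) ≤ K)
    (h2 : K ≤ Gs i) : K = Gs (i + 1) ∨ K = Gs i := by
  have e1 := h.card (i + 1) hi
  have e2 := h.card i hi.le
  have d1 := Subgroup.card_dvd_of_le h1
  have d2 := Subgroup.card_dvd_of_le h2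
  rw [e1] at d1
  rw [e2] at d2
  obtain ⟨k, hk, hk'⟩ := (Nat.dvd_prime_pow hp.out).1 d2
  rw [hk'] at d1
  have := (Nat.pow_dvd_pow_iff_le_right hp.out.one_lt).1 d1
  have : k = n - (i + 1) ∨ k = n - i := by omega
  rcases this with rfl | rfl
  · left
    exact (Subgroup.eq_of_le_of_card_ge h1 (by rw [hk', e1])).symm
  · right
    exact (Subgroup.eq_of_le_of_card_ge h2 (by rw [hk', e2]))

lemma gsg_split {G : Type*} [Group G] (Gs : ℕ → Subgroup G) [∀ j, (Gs j).Normal] (i : ℕ)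
    (H : Subgroup G) (h1 : ∀ g ∈ H, g ∈ Gs i → g ∈ Gs (i + 1)) (h0 : Gs (i + 1) ≤ H)
    (h2 : ∀ g, ∃ z ∈ Gs i, g * z ∈ H) : splitAt Gs (i + 1) := by
  refine ⟨H.map (QuotientGroup.mk' (Gs (i + 1))), ?_⟩
  change ((Gs i).map _).IsComplement' _
  apply Subgroup.isComplement'_of_disjoint_and_mul_eq_univ
  · rw [Subgroup.disjoint_def]
    rintro x ⟨a, ha, rfl⟩ ⟨b, hb, hab⟩
    have hab' : (b : G ⧸ Gs (i + 1)) = a := hab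
    rw [QuotientGroup.eq] at hab'
    have : a ∈ H := by
      have := H.mul_mem hb (h0 hab')
      simpa using this
    simpa using h1 a this ha
  · rw [Set.eq_univ_iff_forall]
    intro x
    obtain ⟨g, rfl⟩ := QuotientGroup.mk_surjective x
    obtain ⟨z, hz, hgz⟩ := h2 g⁻¹
    have hgz' : z⁻¹ * g ∈ H := by simpa using H.inv_mem hgz
    refine ⟨QuotientGroup.mk' _ z, ⟨z, hz, rfl⟩, QuotientGroup.mk' _ (z⁻¹ * g),
      ⟨_, hgz', rfl⟩, ?_⟩
    simp

/-- kernel of an additive function on a group, as a subgroup -/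
def gsgKer {G A : Type*} [Group G] [AddGroup A] (f : G → A) (hf : ∀ g h, f (g * h) = f g + f h) :
    Subgroup G where
  carrier := {g | f g = 0}
  one_mem' := by
    have := hf 1 1
    simpa using this
  mul_mem' := by
    intro a b ha hb
    simp only [Set.mem_ofPred_eq] at *
    rw [hf, ha, hb, add_zero]
  inv_mem' := by
    intro a ha
    simp only [Set.mem_ofPred_eq] at *
    have h1 : f 1 = 0 := by
      have := hf 1 1
      simpa using this
    have := hf a a⁻¹
    rw [mul_inv_cancel, h1, ha, zero_add] at this
    exact this.symm

lemma gsg_pow {G A : Type*} [Group G] [AddGroup A] (f : G → A)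
    (hf : ∀ g h, f (g * h) = f g + f h) (z : G) (k : ℕ) : f (z ^ k) = k • f z := by
  induction k with
  | zero =>
    have := hf 1 1
    simpa using this
  | succ k ih => rw [pow_succ, hf, ih, succ_nsmul]

/-- Characters vanishing on `Gs i` are spanned by the `χ j`, `j < i` split. -/
lemma gsg_span {p n : ℕ} [hp : Fact p.Prime] {G : Type*} [Group G] [Finite G]
    {Gs : ℕ → Subgroup G} [∀ j, (Gs j).Normal] (hG : GFilt p n Gs) (h0 : Gs 0 = ⊤)
    (χ : ℕ → G → ZMod p)
    (hχ : ∀ i < n, splitAt Gs (i + 1) → ∀ g h, χ i (g * h) = χ i g + χ i h)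
    (hχ0 : ∀ i < n, splitAt Gs (i + 1) → ∀ g ∈ Gs (i + 1), χ i g = 0)
    (hχ1 : ∀ i < n, splitAt Gs (i + 1) → ∀ g ∈ Gs i, χ i g = 0 → g ∈ Gs (i + 1)) :
    ∀ i ≤ n, ∀ f : G → ZMod p, (∀ g h, f (g * h) = f g + f h) → (∀ g ∈ Gs i, f g = 0) →
    ∃ c : ℕ → ZMod p, (∀ j, c j ≠ 0 → j < i ∧ splitAt Gs (j + 1)) ∧
      ∀ g, f g = ∑ j ∈ Finset.range i, c j * χ j g := by
  intro i
  induction i with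
  | zero =>
    intro _ f hf hf0
    refine ⟨fun _ => 0, by simp, fun g => ?_⟩
    simpa using hf0 g (by rw [h0]; trivial)
  | succ i ih =>
    intro hi f hf hf0
    have hi' : i < n := hi
    by_cases hv : ∀ g ∈ Gs i, f g = 0
    · obtain ⟨c, hc, hc'⟩ := ih hi'.le f hf hv
      refine ⟨c, fun j hj => ⟨(hc j hj).1.trans (Nat.lt_succ_self i), (hc j hj).2⟩, fun g => ?_⟩
      have : c i = 0 := by
        by_contra h
        exact lt_irrefl _ (hc i h).1
      rw [Finset.sum_range_succ, this, zero_mul, add_zero, hc']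
    · push Not at hv
      obtain ⟨z, hz, hfz⟩ := hv
      have key : ∀ f' : G → ZMod p, (hf' : ∀ g h, f' (g * h) = f' g + f' h) →
          (∀ g ∈ Gs (i + 1), f' g = 0) → gsgKer f' hf' ⊓ Gs i = Gs (i + 1) ∨
            gsgKer f' hf' ⊓ Gs i = Gs i := by
        intro f' hf' h
        exact hG.mid hi' _ (le_inf h (hG.anti i hi').le) inf_le_right
      have hs : splitAt Gs (i + 1) := by
        apply gsg_split Gs i (gsgKer f hf)
        · intro g hg hg'
          rcases key f hf hf0 with h | h
          · rw [← h]; exact ⟨hg, hg'⟩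
          · exfalso
            have : z ∈ gsgKer f hf ⊓ Gs i := by rw [h]; exact hz
            exact hfz this.1
        · exact hf0
        · intro g
          refine ⟨z ^ (-(f g) / f z).val, Subgroup.pow_mem _ hz _, ?_⟩
          change f _ = 0
          rw [hf, gsg_pow f hf, nsmul_eq_mul, ZMod.natCast_zmod_val]
          field_simp
          ring
      have hzn : z ∉ Gs (i + 1) := fun h => hfz (hf0 z h)
      have hχz : χ i z ≠ 0 := fun h => hzn (hχ1 i hi' hs z hz h)
      have hm := hχ i hi' hs
      let f' : G → ZMod p := fun g => f g - f z / χ i z * χ i g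
      have hf' : ∀ g h, f' (g * h) = f' g + f' h := by
        intro g h
        simp only [f', hf, hm]; ring
      have hf'z : f' z = 0 := by
        simp only [f']; field_simp; ring
      have hf'0 : ∀ g ∈ Gs (i + 1), f' g = 0 := by
        intro g hg
        simp only [f', hf0 g hg, hχ0 i hi' hs g hg]; ring
      obtain ⟨c, hc, hc'⟩ := ih hi'.le f' hf' (by
        rcases key f' hf' hf'0 with h | h
        · exfalso
          have : z ∈ gsgKer f' hf' ⊓ Gs i := ⟨hf'z, hz⟩
          rw [h] at this
          exact hzn this
        · intro g hg
          rw [← h] at hg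
          exact hg.1)
      refine ⟨fun j => if j = i then f z / χ i z else c j, ?_, ?_⟩
      · intro j hj
        by_cases hji : j = i
        · subst hji; exact ⟨Nat.lt_succ_self _, hs⟩
        · simp only [hji, if_false] at hj
          exact ⟨(hc j hj).1.trans (Nat.lt_succ_self i), (hc j hj).2⟩
      · intro g
        rw [Finset.sum_range_succ]
        have : ∑ j ∈ Finset.range i, (if j = i then f z / χ i z else c j) * χ j g =
            ∑ j ∈ Finset.range i, c j * χ j g := by
          apply Finset.sum_congr rfl
          intro j hj
          rw [if_neg (Finset.mem_range.1 hj).ne]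
        rw [this, ← hc']
        simp [f']

/-! ### The generic action -/

structure GAct (p n : ℕ) {G : Type*} [Group G] (Gs : ℕ → Subgroup G) [∀ j, (Gs j).Normal]
    (D : (i : ℕ) → MvPolynomial (Fin i) (ZMod p))
    (act : (i : ℕ) → G →* RingAut (MvPolynomial (Fin i) (ZMod p))) : Prop where
  faith : ∀ i ≤ n, ∀ g, act i g = 1 ↔ g ∈ Gs i
  compat : ∀ i < n, ∀ g q, act (i + 1) g (rename Fin.castSucc q) = rename Fin.castSucc (act i g q)
  fixed : ∀ i < n, ∀ g, act (i + 1) g (X (Fin.last i) ^ p - X (Fin.last i) -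
    rename Fin.castSucc (D i)) = X (Fin.last i) ^ p - X (Fin.last i) - rename Fin.castSucc (D i)
  split0 : ∀ i < n, splitAt Gs (i + 1) → D i = 0

lemma gsg_hom_ext {p i : ℕ} {R : Type*} [CommRing R]
    {f g : MvPolynomial (Fin (i + 1)) (ZMod p) →+* R}
    (h1 : ∀ q, f (rename Fin.castSucc q) = g (rename Fin.castSucc q))
    (h2 : f (X (Fin.last i)) = g (X (Fin.last i))) : f = g := by
  apply MvPolynomial.ringHom_ext
  · intro r
    have := h1 (C r)
    simpa using this
  · intro k
    refine Fin.lastCases h2 (fun k => ?_) k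
    have := h1 (X k)
    simpa using this

section
variable {p n : ℕ} [hp : Fact p.Prime] {G : Type*} [Group G] [Finite G]
    {Gs : ℕ → Subgroup G} [∀ j, (Gs j).Normal]
    {D : (i : ℕ) → MvPolynomial (Fin i) (ZMod p)}
    {act : (i : ℕ) → G →* RingAut (MvPolynomial (Fin i) (ZMod p))}

lemma GAct.shift (hA : GAct p n Gs D act) {i : ℕ} (hi : i < n) (g : G)
    (h : rename Fin.castSucc (act i g (D i)) = rename (Fin.castSucc (n := i)) (D i)) :
    ∃ c : ZMod p, act (i + 1) g (X (Fin.last i)) = X (Fin.last i) + C c := by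
  apply gsg_root (p := p)
  have := hA.fixed i hi g
  simp only [map_sub, map_pow, hA.compat i hi, h] at this
  linear_combination this

lemma GAct.shift_mem (hA : GAct p n Gs D act) {i : ℕ} (hi : i < n) {g : G} (hg : g ∈ Gs i) :
    ∃ c : ZMod p, act (i + 1) g (X (Fin.last i)) = X (Fin.last i) + C c := by
  apply hA.shift hi
  rw [(hA.faith i hi.le g).2 hg]; rfl

lemma GAct.shift_split (hA : GAct p n Gs D act) {i : ℕ} (hi : i < n) (hs : splitAt Gs (i + 1))
    (g : G) :
    ∃ c : ZMod p, act (i + 1) g (X (Fin.last i)) = X (Fin.last i) + C c := by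
  apply hA.shift hi
  rw [hA.split0 i hi hs]; simp

lemma GAct.fixC (act : (i : ℕ) → G →* RingAut (MvPolynomial (Fin i) (ZMod p)))
    (i : ℕ) (g : G) (c : ZMod p) : act i g (C c) = C c := by
  have : (RingEquiv.toRingHom (act i g)).comp C = C :=
    RingHom.ext_zmod _ _
  exact congrArg (fun f => f c) this

lemma GAct.shift_mul {i : ℕ} {g h : G} {c d : ZMod p}
    (hg : act (i + 1) g (X (Fin.last i)) = X (Fin.last i) + C c)
    (hh : act (i + 1) h (X (Fin.last i)) = X (Fin.last i) + C d) :
    act (i + 1) (g * h) (X (Fin.last i)) = X (Fin.last i) + C (c + d) := by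
  rw [map_mul, RingAut.mul_apply, hh, map_add, GAct.fixC, hg, map_add, add_assoc]

lemma GAct.shift_zero (hA : GAct p n Gs D act) {i : ℕ} (hi : i < n) {g : G} (hg : g ∈ Gs i)
    (h : act (i + 1) g (X (Fin.last i)) = X (Fin.last i)) : g ∈ Gs (i + 1) := by
  rw [← hA.faith (i + 1) hi]
  have : (RingEquiv.toRingHom (act (i + 1) g)) =
      RingHom.id _ := by
    apply gsg_hom_ext
    · intro q
      have := hA.compat i hi g q
      rw [(hA.faith i hi.le g).2 hg] at this
      exact this
    · exact h
  ext1 q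
  exact congrArg (fun f => f q) this

lemma GAct.shift_unique {i : ℕ} {g : G} {c d : ZMod p}
    (hg : act (i + 1) g (X (Fin.last i)) = X (Fin.last i) + C c)
    (hh : act (i + 1) g (X (Fin.last i)) = X (Fin.last i) + C d) : c = d := by
  rw [hg] at hh
  exact C_injective _ _ (add_left_cancel hh)

lemma GAct.shift_pow {i : ℕ} {g : G} {c : ZMod p}
    (hg : act (i + 1) g (X (Fin.last i)) = X (Fin.last i) + C c) (k : ℕ) :
    act (i + 1) (g ^ k) (X (Fin.last i)) = X (Fin.last i) + C (k * c) := by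
  induction k with
  | zero => simp
  | succ k ih =>
    rw [pow_succ, GAct.shift_mul ih hg]; push_cast; ring_nf

lemma GAct.shift_surj (hA : GAct p n Gs D act) (hG : GFilt p n Gs) {i : ℕ} (hi : i < n)
    (c : ZMod p) : ∃ z ∈ Gs i, act (i + 1) z (X (Fin.last i)) = X (Fin.last i) + C c := by
  obtain ⟨z, hz, hz'⟩ := Set.exists_of_ssubset (hG.anti i hi)
  obtain ⟨d, hd⟩ := hA.shift_mem hi hz
  have hd0 : d ≠ 0 := by
    rintro rfl
    exact hz' (hA.shift_zero hi hz (by simpa using hd))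
  refine ⟨z ^ (c / d).val, Subgroup.pow_mem _ hz _, ?_⟩
  rw [GAct.shift_pow hd, ZMod.natCast_zmod_val, div_mul_cancel₀ _ hd0]

/-! ### Specialization -/

variable {F Ω : Type*} [Field F] [CharP F p] [Field Ω] [Algebra F Ω]

/-- the specialization map -/
noncomputable def gsgPhi (p : ℕ) (F : Type*) {Ω : Type*} [Field F] [CharP F p] [Field Ω]
    [Algebra F Ω] (α : ℕ → Ω) (i : ℕ) : MvPolynomial (Fin i) (ZMod p) →+* Ω :=
  eval₂Hom ((algebraMap F Ω).comp (ZMod.castHom (dvd_refl p) F)) (fun k => α ((k : ℕ) + 1))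

@[simp] lemma gsgPhi_rename (α : ℕ → Ω) (i : ℕ) (q : MvPolynomial (Fin i) (ZMod p)) :
    gsgPhi p F α (i + 1) (rename Fin.castSucc q) = gsgPhi p F α i q := by
  simp only [gsgPhi, coe_eval₂Hom, eval₂_rename]
  rfl

@[simp] lemma gsgPhi_last (α : ℕ → Ω) (i : ℕ) :
    gsgPhi p F α (i + 1) (X (Fin.last i)) = α (i + 1) := by
  simp [gsgPhi]

@[simp] lemma gsgPhi_C (α : ℕ → Ω) (i : ℕ) (c : ZMod p) :
    gsgPhi p F α i (C c) = algebraMap F Ω (ZMod.castHom (dvd_refl p) F c) := by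
  simp [gsgPhi]

/-- σ and g agree through the specialization -/
def gsgRel (act : (i : ℕ) → G →* RingAut (MvPolynomial (Fin i) (ZMod p))) (F : Type*)
    {Ω : Type*} [Field F] [CharP F p] [Field Ω]
    [Algebra F Ω] (α : ℕ → Ω) (i : ℕ) (σ : Ω ≃ₐ[F] Ω) (g : G) : Prop :=
  ∀ q, σ (gsgPhi p F α i q) = gsgPhi p F α i (act i g q)

lemma gsgRel_of {α : ℕ → Ω} {i : ℕ} {σ : Ω ≃ₐ[F] Ω} {g : G} (hA : GAct p n Gs D act) (hi : i < n)
    (h : gsgRel act F α i σ g)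
    (hl : σ (α (i + 1)) = gsgPhi p F α (i + 1) (act (i + 1) g (X (Fin.last i)))) :
    gsgRel act F α (i + 1) σ g := by
  have : ((σ : Ω →ₐ[F] Ω) : Ω →+* Ω).comp (gsgPhi p F α (i + 1)) =
      (gsgPhi p F α (i + 1)).comp
        (RingEquiv.toRingHom (act (i + 1) g)) := by
    apply gsg_hom_ext
    · intro q
      simpa [hA.compat i hi] using h q
    · simpa using hl
  intro q
  exact congrArg (fun f => f q) this

lemma gsgRel_down {α : ℕ → Ω} {i : ℕ} {σ : Ω ≃ₐ[F] Ω} {g : G} (hA : GAct p n Gs D act) (hi : i < n)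
    (h : gsgRel act F α (i + 1) σ g) : gsgRel act F α i σ g := by
  intro q
  have := h (rename Fin.castSucc q)
  rwa [hA.compat i hi, gsgPhi_rename, gsgPhi_rename] at this

lemma gsgRel_le {α : ℕ → Ω} {i k : ℕ} {σ : Ω ≃ₐ[F] Ω} {g : G} (hA : GAct p n Gs D act)
    (hik : i ≤ k) (hk : k ≤ n)
    (h : gsgRel act F α k σ g) : gsgRel act F α i σ g := by
  induction k, hik using Nat.le_induction with
  | base => exact h
  | succ k hik ih => exact ih (by omega) (gsgRel_down hA (by omega) h)

lemma gsgRel_zero (α : ℕ → Ω) (σ : Ω ≃ₐ[F] Ω) (g : G) : gsgRel act F α 0 σ g := by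
  intro q
  obtain ⟨c, rfl⟩ := C_surjective (Fin 0) q
  rw [GAct.fixC, gsgPhi_C, AlgEquiv.commutes]

lemma gsgRel_mul {α : ℕ → Ω} {i : ℕ} {σ τ : Ω ≃ₐ[F] Ω} {g h : G} 
    (h1 : gsgRel act F α i σ g) (h2 : gsgRel act F α i τ h) :
    gsgRel act F α i (σ * τ) (g * h) := by
  intro q
  rw [AlgEquiv.mul_apply, h2, h1, map_mul, RingAut.mul_apply]

lemma gsgRel_one {α : ℕ → Ω} {i : ℕ} : gsgRel act F α i 1 1 := by
  intro q
  simp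

lemma gsgRel_inv {α : ℕ → Ω} {i : ℕ} {σ : Ω ≃ₐ[F] Ω} {g : G} 
    (h1 : gsgRel act F α i σ g) :
    gsgRel act F α i σ⁻¹ g⁻¹ := by
  intro q
  apply σ.injective
  rw [h1, ← RingAut.mul_apply, ← map_mul, mul_inv_cancel, map_one, ← AlgEquiv.mul_apply,
    mul_inv_cancel]
  rfl

lemma gsgRel_unique (α : ℕ → Ω) (hA : GAct p n Gs D act) {g : G} {i : ℕ} (hi : i ≤ n)
    (h1 : gsgRel act F α i 1 g) (h0 : Gs 0 = ⊤) : g ∈ Gs i := by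
  induction i with
  | zero => rw [h0]; trivial
  | succ i ih =>
    have h := ih (by omega) (gsgRel_down hA hi h1)
    obtain ⟨c, hc⟩ := hA.shift_mem hi h
    have := h1 (X (Fin.last i))
    rw [hc, map_add, gsgPhi_C] at this
    have : c = 0 := by
      apply (ZMod.castHom (dvd_refl p) F).injective
      apply (algebraMap F Ω).injective
      simpa using this
    apply hA.shift_zero hi h
    simp [hc, this]

variable {α : ℕ → Ω} {a : ℕ → F} 

lemma gsgRel_exists (hA : GAct p n Gs D act) (hG : GFilt p n Gs) 
    (hα : ∀ i < n, α (i + 1) ^ p - α (i + 1) = gsgPhi p F α i (D i) + algebraMap F Ω (a (i + 1)))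
    (σ : Ω ≃ₐ[F] Ω) (i : ℕ) (hi : i ≤ n) : ∃ g, gsgRel act F α i σ g := by
  induction i with
  | zero => exact ⟨1, gsgRel_zero _ _ _⟩
  | succ i ih =>
    obtain ⟨g, hg⟩ := ih (by omega)
    have hi' : i < n := hi
    have : CharP Ω p := charP_of_injective_algebraMap (algebraMap F Ω).injective p
    have h1 : σ (α (i + 1)) ^ p - σ (α (i + 1)) =
        (gsgPhi p F α (i + 1) (act (i + 1) g (X (Fin.last i)))) ^ p -
        (gsgPhi p F α (i + 1) (act (i + 1) g (X (Fin.last i)))) := by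
      have e1 := congrArg σ (hα i hi')
      have e2 := congrArg (gsgPhi p F α (i + 1)) (hA.fixed i hi' g)
      simp only [map_sub, map_add, map_pow, hA.compat i hi', gsgPhi_rename, gsgPhi_last,
        AlgEquiv.commutes, hg (D i)] at e1 e2
      linear_combination e1 - e2 - hα i hi'
    obtain ⟨c, hc⟩ := gsg_root ((algebraMap F Ω).comp (ZMod.castHom (dvd_refl p) F)) h1
    obtain ⟨z, hz, hz'⟩ := hA.shift_surj hG hi' c
    refine ⟨g * z, gsgRel_of hA hi' ?_ ?_⟩
    · intro q
      rw [hg, map_mul, (hA.faith i hi'.le z).2 hz, mul_one]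
    · rw [hc, map_mul, RingAut.mul_apply, hz', map_add, GAct.fixC, map_add, gsgPhi_C]
      rfl

end

section
variable {p n : ℕ} [hp : Fact p.Prime] {G : Type*} [Group G] [Finite G]
    {Gs : ℕ → Subgroup G} [∀ j, (Gs j).Normal]
    {D : (i : ℕ) → MvPolynomial (Fin i) (ZMod p)}
    {act : (i : ℕ) → G →* RingAut (MvPolynomial (Fin i) (ZMod p))}
    {F Ω : Type*} [Field F] [CharP F p] [Field Ω] [Algebra F Ω]
    {α : ℕ → Ω} {a : ℕ → F}

/-- the image of the Galois group -/
def gsgIm (act : (i : ℕ) → G →* RingAut (MvPolynomial (Fin i) (ZMod p))) (F : Type*)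
    {Ω : Type*} [Field F] [CharP F p] [Field Ω]
    [Algebra F Ω] (α : ℕ → Ω) (i : ℕ) : Subgroup G where
  carrier := {g | ∃ σ : Ω ≃ₐ[F] Ω, gsgRel act F α i σ g}
  one_mem' := ⟨1, gsgRel_one⟩
  mul_mem' := by
    rintro g h ⟨σ, hσ⟩ ⟨τ, hτ⟩
    exact ⟨σ * τ, gsgRel_mul hσ hτ⟩
  inv_mem' := by
    rintro g ⟨σ, hσ⟩
    exact ⟨σ⁻¹, gsgRel_inv hσ⟩

lemma gsgRel_mem (hA : GAct p n Gs D act) {i : ℕ} (hi : i ≤ n) {g z : G} (hz : z ∈ Gs i)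
    {σ : Ω ≃ₐ[F] Ω} (h : gsgRel act F α i σ g) : gsgRel act F α i σ (g * z) := by
  intro q
  rw [h, map_mul, (hA.faith i hi z).2 hz, mul_one]

lemma gsg_surj (hA : GAct p n Gs D act) (hG : GFilt p n Gs) (h0 : Gs 0 = ⊤)
    (hα : ∀ i < n, α (i + 1) ^ p - α (i + 1) = gsgPhi p F α i (D i) + algebraMap F Ω (a (i + 1)))
    (E : IntermediateField F Ω) (hE : ∀ i < n, α (i + 1) ∈ E)
    (hfix : ∀ y ∈ E, (∀ σ : Ω ≃ₐ[F] Ω, σ y = y) → ∃ x : F, algebraMap F Ω x = y)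
    (ha : ∀ c : ℕ → ZMod p, (∀ j, c j ≠ 0 → j < n ∧ splitAt Gs (j + 1)) →
      (∃ y : F, (∑ j ∈ Finset.range n, ZMod.castHom (dvd_refl p) F (c j) * a (j + 1)) =
        y ^ p - y) → ∀ j, c j = 0)
    (i : ℕ) (hi : i ≤ n) : gsgIm act F α i = ⊤ := by
  have : CharP Ω p := charP_of_injective_algebraMap (algebraMap F Ω).injective p
  have hex : ∀ (i : ℕ) (g : G), ∃ c : ZMod p, i < n → splitAt Gs (i + 1) →
      act (i + 1) g (X (Fin.last i)) = X (Fin.last i) + C c := by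
    intro i g
    by_cases h : i < n ∧ splitAt Gs (i + 1)
    · obtain ⟨c, hc⟩ := hA.shift_split h.1 h.2 g
      exact ⟨c, fun _ _ => hc⟩
    · exact ⟨0, fun h1 h2 => absurd ⟨h1, h2⟩ h⟩
  choose χ hχ using hex
  have hχm : ∀ i < n, splitAt Gs (i + 1) → ∀ g h, χ i (g * h) = χ i g + χ i h := by
    intro i hi hs g h
    exact GAct.shift_unique (hχ i _ hi hs) (GAct.shift_mul (hχ i g hi hs) (hχ i h hi hs))
  have hχ0 : ∀ i < n, splitAt Gs (i + 1) → ∀ g ∈ Gs (i + 1), χ i g = 0 := by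
    intro i hi hs g hg
    refine GAct.shift_unique (hχ i _ hi hs) ?_
    rw [(hA.faith _ hi g).2 hg]; simp
  have hχ1 : ∀ i < n, splitAt Gs (i + 1) → ∀ g ∈ Gs i, χ i g = 0 → g ∈ Gs (i + 1) := by
    intro i hi hs g hg h
    apply hA.shift_zero hi hg
    rw [hχ i _ hi hs, h]; simp
  induction i with
  | zero =>
    rw [eq_top_iff]
    intro g _
    exact ⟨1, gsgRel_zero _ _ _⟩
  | succ i ih =>
    have hi' : i < n := hi
    have ih := ih hi'.le
    set H := gsgIm act F α (i + 1) with hH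
    have hH0 : Gs (i + 1) ≤ H := by
      intro g hg
      have := gsgRel_mem (α := α) (F := F) hA hi hg gsgRel_one
      rw [one_mul] at this
      exact ⟨1, this⟩
    have hH2 : ∀ g, ∃ z ∈ Gs i, g * z ∈ H := by
      intro g
      obtain ⟨σ, hσ⟩ : g ∈ gsgIm act F α i := by rw [ih]; trivial
      obtain ⟨g', hg'⟩ := gsgRel_exists hA hG hα σ (i + 1) hi
      refine ⟨g⁻¹ * g', ?_, σ, by simpa using hg'⟩
      have := gsgRel_mul (gsgRel_inv hσ) (gsgRel_down hA hi' hg')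
      rw [inv_mul_cancel] at this
      exact gsgRel_unique α hA hi'.le this h0
    rcases hG.mid hi' (H ⊓ Gs i) (le_inf hH0 (hG.anti i hi').le) inf_le_right with h | h
    swap
    · rw [eq_top_iff]
      intro g _
      obtain ⟨z, hz, hgz⟩ := hH2 g
      rw [← h] at hz
      simpa using H.mul_mem hgz (H.inv_mem hz.1)
    exfalso
    have hs : splitAt Gs (i + 1) := by
      apply gsg_split Gs i H _ hH0 hH2
      intro g hg hg'
      rw [← h]; exact ⟨hg, hg'⟩
    choose ζ hζ hζH using hH2
    have hm := hχm i hi' hs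
    have hwd : ∀ g z, z ∈ Gs i → g * z ∈ H → χ i (g * ζ g) = χ i (g * z) := by
      intro g z hz hgz
      have hmem : (g * ζ g)⁻¹ * (g * z) ∈ H ⊓ Gs i := by
        refine ⟨H.mul_mem (H.inv_mem (hζH g)) hgz, ?_⟩
        have : (g * ζ g)⁻¹ * (g * z) = (ζ g)⁻¹ * z := by group
        rw [this]
        exact (Gs i).mul_mem ((Gs i).inv_mem (hζ g)) hz
      rw [h] at hmem
      have h1 := hχ0 i hi' hs _ hmem
      have h2 := hm (g * ζ g) ((g * ζ g)⁻¹ * (g * z))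
      rw [h1, add_zero, mul_inv_cancel_left] at h2
      exact h2.symm
    obtain ⟨c, hc, hc'⟩ := gsg_span hG h0 χ hχm hχ0 hχ1 i hi'.le (fun g => χ i (g * ζ g))
      (by
        intro g k
        have e : g * ζ g * (k * ζ k) = g * k * (k⁻¹ * ζ g * k * ζ k) := by group
        rw [← hm, e]
        apply hwd
        · apply (Gs i).mul_mem _ (hζ k)
          have := (inferInstance : (Gs i).Normal).conj_mem _ (hζ g) k⁻¹
          simpa using this
        · rw [← e]
          exact H.mul_mem (hζH g) (hζH k))
      (by
        intro g hg
        apply hχ0 i hi' hs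
        rw [← h]
        exact ⟨hζH g, (Gs i).mul_mem hg (hζ g)⟩)
    let κ : ZMod p →+* Ω := (algebraMap F Ω).comp (ZMod.castHom (dvd_refl p) F)
    let y : Ω := α (i + 1) - ∑ j ∈ Finset.range i, κ (c j) * α (j + 1)
    have hσα : ∀ (σ : Ω ≃ₐ[F] Ω) g, gsgRel act F α (i + 1) σ g → ∀ j ≤ i, splitAt Gs (j + 1) →
        σ (α (j + 1)) = α (j + 1) + κ (χ j g) := by
      intro σ g hg j hj hjs
      have h1 := gsgRel_le hA (show j + 1 ≤ i + 1 by omega) hi hg (X (Fin.last j))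
      rw [hχ j g (by omega) hjs, map_add, gsgPhi_last, gsgPhi_C] at h1
      exact h1
    have hκ : ∀ c, κ c ∈ E := fun c => E.algebraMap_mem _
    obtain ⟨x, hx⟩ := hfix y (by
        apply E.sub_mem (hE i hi')
        apply E.sum_mem
        intro j hj
        have := Finset.mem_range.1 hj
        exact E.mul_mem (hκ _) (hE j (by omega))) (by
      intro σ
      obtain ⟨g, hg⟩ := gsgRel_exists hA hG hα σ (i + 1) hi
      have hgH : g ∈ H := ⟨σ, hg⟩
      have e1 : χ i g = ∑ j ∈ Finset.range i, c j * χ j g := by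
        rw [← hc' g, hwd g 1 (one_mem _) (by simpa using hgH), mul_one]
      have e2 : ∀ j ∈ Finset.range i, σ (κ (c j) * α (j + 1)) =
          κ (c j) * α (j + 1) + κ (c j) * κ (χ j g) := by
        intro j hj
        have hσκ : σ (κ (c j)) = κ (c j) := σ.commutes _
        by_cases hcj : c j = 0
        · simp [hcj]
        · rw [map_mul, hσκ, hσα σ g hg j (Finset.mem_range.1 hj).le (hc j hcj).2]
          ring
      simp only [y]
      rw [map_sub, map_sum, Finset.sum_congr rfl e2, Finset.sum_add_distrib,
        hσα σ g hg i le_rfl hs, e1, map_sum]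
      simp only [map_mul]
      ring)
    have hαs : ∀ j ≤ i, splitAt Gs (j + 1) →
        α (j + 1) ^ p - α (j + 1) = algebraMap F Ω (a (j + 1)) := by
      intro j hj hjs
      rw [hα j (by omega), hA.split0 j (by omega) hjs, map_zero, zero_add]
    have hy : y ^ p - y = algebraMap F Ω (a (i + 1) -
        ∑ j ∈ Finset.range i, ZMod.castHom (dvd_refl p) F (c j) * a (j + 1)) := by
      have e3 : ∀ j ∈ Finset.range i, (κ (c j) * α (j + 1)) ^ p - κ (c j) * α (j + 1) =
          κ (c j) * algebraMap F Ω (a (j + 1)) := by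
        intro j hj
        by_cases hcj : c j = 0
        · simp [hcj, hp.out.ne_zero]
        · rw [mul_pow, gsg_frob, ← hαs j (Finset.mem_range.1 hj).le (hc j hcj).2]
          ring
      simp only [y]
      rw [sub_pow_char, sum_pow_char, map_sub, map_sum, ← hαs i le_rfl hs]
      simp only [map_mul]
      change _ = _ - ∑ j ∈ Finset.range i, κ (c j) * _
      rw [← Finset.sum_congr rfl e3, Finset.sum_sub_distrib]
      ring
    have hx' : a (i + 1) - ∑ j ∈ Finset.range i, ZMod.castHom (dvd_refl p) F (c j) * a (j + 1) =
        x ^ p - x := by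
      apply (algebraMap F Ω).injective
      rw [← hy, ← hx, map_sub, map_pow]
    have hfin := ha (fun j => if j = i then 1 else - c j) (by
      intro j hj
      by_cases hji : j = i
      · subst hji; exact ⟨hi', hs⟩
      · simp only [hji, if_false] at hj
        have := hc j (by simpa using hj)
        exact ⟨this.1.trans hi', this.2⟩) ⟨x, by
        rw [← hx', ← Finset.sum_subset (Finset.range_subset_range.2 hi), Finset.sum_range_succ,
          if_pos rfl, map_one, one_mul, sub_eq_neg_add, ← Finset.sum_neg_distrib]
        · congr 1
          apply Finset.sum_congr rfl
          intro j hj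
          rw [if_neg (Finset.mem_range.1 hj).ne, map_neg, neg_mul]
        · intro j _ hj
          have hj' : i < j := by simpa [Nat.lt_succ_iff] using hj
          have : c j = 0 := by
            by_contra hcj
            have := (hc j hcj).1
            omega
          rw [if_neg hj'.ne', this]; simp⟩ i
    simp at hfin

end

section
variable {p : ℕ} [hp : Fact p.Prime] {F Ω : Type*} [Field F] [CharP F p] [Field Ω] [Algebra F Ω]

lemma gsg_sep_step {x : Ω} (h : x ^ p - x ∈ separableClosure F Ω) : x ∈ separableClosure F Ω := by
  set E := separableClosure F Ω with hE
  have : CharP E p := charP_of_injective_algebraMap (algebraMap F E).injective p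
  have hx : x ∈ separableClosure E Ω := by
    rw [mem_separableClosure_iff]
    let f : Polynomial E := Polynomial.X ^ p - Polynomial.X - Polynomial.C ⟨_, h⟩
    have hf : f.Separable := by
      rw [Polynomial.separable_def]
      have : Polynomial.derivative f = -1 := by
        simp [f, Polynomial.derivative_X_pow]
      rw [this]
      exact isCoprime_one_right.neg_right
    apply hf.of_dvd
    apply minpoly.dvd
    simp [f]
  rw [separableClosure.separableClosure_eq_bot] at hx
  obtain ⟨y, rfl⟩ := IntermediateField.mem_bot.1 hx
  exact y.2

lemma gsgPhi_mem {α : ℕ → Ω} {i : ℕ} {E : IntermediateField F Ω} (h : ∀ j < i, α (j + 1) ∈ E)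
    (q : MvPolynomial (Fin i) (ZMod p)) : gsgPhi p F α i q ∈ E := by
  induction q using MvPolynomial.induction_on with
  | C c => rw [gsgPhi_C]; exact E.algebraMap_mem _
  | add f g hf hg => rw [map_add]; exact E.add_mem hf hg
  | mul_X f k hf =>
    rw [map_mul]
    refine E.mul_mem hf ?_
    simpa [gsgPhi] using h k k.2

lemma gsg_sep {n : ℕ} {α : ℕ → Ω} {a : ℕ → F} {D : (i : ℕ) → MvPolynomial (Fin i) (ZMod p)}
    (hα : ∀ i < n, α (i + 1) ^ p - α (i + 1) = gsgPhi p F α i (D i) + algebraMap F Ω (a (i + 1)))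
    (i : ℕ) (hi : i < n) : α (i + 1) ∈ separableClosure F Ω := by
  induction i using Nat.strong_induction_on with
  | _ i ih =>
    apply gsg_sep_step (p := p)
    rw [hα i hi]
    exact add_mem (gsgPhi_mem (fun j hj => ih j hj (by omega)) _)
      ((separableClosure F Ω).algebraMap_mem _)

end

lemma gsg_fix {F : Type*} [Field F] (y : AlgebraicClosure F)
    (hy : y ∈ separableClosure F (AlgebraicClosure F))
    (h : ∀ σ : AlgebraicClosure F ≃ₐ[F] AlgebraicClosure F, σ y = y) :
    ∃ x : F, algebraMap F (AlgebraicClosure F) x = y := by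
  have := (InfiniteGalois.mem_bot_iff_fixed (k := F)
    (⟨y, hy⟩ : separableClosure F (AlgebraicClosure F))).2 (by
      intro σ
      obtain ⟨τ, hτ⟩ := AlgEquiv.restrictNormalHom_surjective (F := F)
        (K₁ := separableClosure F (AlgebraicClosure F)) (AlgebraicClosure F) σ
      apply Subtype.ext
      rw [← hτ]
      have := AlgEquiv.restrictNormal_commutes τ (separableClosure F (AlgebraicClosure F)) ⟨y, hy⟩
      exact this.trans (h τ))
  obtain ⟨x, hx⟩ := IntermediateField.mem_bot.1 this
  exact ⟨x, congrArg Subtype.val hx⟩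

lemma gsg_mulEquiv {A B : Type*} [Group A] [Group B] (Q : A → B → Prop)
    (h1 : ∀ x, ∃ y, Q x y) (h2 : ∀ x y y', Q x y → Q x y' → y = y') (h3 : ∀ y, ∃ x, Q x y)
    (h4 : ∀ x x' y, Q x y → Q x' y → x = x')
    (h5 : ∀ x x' y y', Q x y → Q x' y' → Q (x * x') (y * y')) :
    ∃ e : A ≃* B, ∀ x, Q x (e x) := by
  choose f hf using h1
  refine ⟨MulEquiv.mk' (Equiv.ofBijective f ⟨?_, ?_⟩) ?_, fun x => hf x⟩
  · intro x x' h
    exact h4 x x' _ (hf x) (h ▸ hf x')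
  · intro y
    obtain ⟨x, hx⟩ := h3 y
    exact ⟨x, h2 x _ _ (hf x) hx⟩
  · intro x x'
    exact h2 _ _ _ (hf _) (h5 _ _ _ _ (hf x) (hf x'))

section
variable {p n : ℕ} [hp : Fact p.Prime] {G : Type*} [Group G] [Finite G]
    {Gs : ℕ → Subgroup G} [∀ j, (Gs j).Normal]
    {D : (i : ℕ) → MvPolynomial (Fin i) (ZMod p)}
    {act : (i : ℕ) → G →* RingAut (MvPolynomial (Fin i) (ZMod p))}
    {F : Type*} [Field F] [CharP F p]
    {α : ℕ → AlgebraicClosure F} {a : ℕ → F}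

lemma gsg_alpha_mem (F : Type*) [Field F] (α : ℕ → AlgebraicClosure F) {i j : ℕ} (h : j < i) :
    α (j + 1) ∈ towerField F α i :=
  IntermediateField.subset_adjoin _ _ ⟨j + 1, by omega, by omega, rfl⟩

lemma gsg_galois (hA : GAct p n Gs D act) (hG : GFilt p n Gs)
    (hα : ∀ i < n, α (i + 1) ^ p - α (i + 1) =
      gsgPhi p F α i (D i) + algebraMap F (AlgebraicClosure F) (a (i + 1)))
    (i : ℕ) (hi : i ≤ n) : IsGalois F (towerField F α i) := by
  have hs : Algebra.IsSeparable F (towerField F α i) := by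
    rw [towerField, IntermediateField.isSeparable_adjoin_iff_isSeparable]
    rintro x ⟨j, h1, h2, rfl⟩
    obtain ⟨k, rfl⟩ : ∃ k, j = k + 1 := ⟨j - 1, by omega⟩
    exact mem_separableClosure_iff.1 (gsg_sep hα k (by omega))
  have hn : Normal F (towerField F α i) := by
    rw [IntermediateField.normal_iff_forall_map_le']
    intro σ
    rw [towerField, IntermediateField.adjoin_map, IntermediateField.adjoin_le_iff]
    rintro _ ⟨x, ⟨j, h1, h2, rfl⟩, rfl⟩
    obtain ⟨k, rfl⟩ : ∃ k, j = k + 1 := ⟨j - 1, by omega⟩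
    obtain ⟨g, hg⟩ := gsgRel_exists hA hG hα σ i hi
    have h3 := hg (X ⟨k, by omega⟩)
    have h4 : gsgPhi p F α i (X ⟨k, by omega⟩) = α (k + 1) := by simp [gsgPhi]
    rw [h4] at h3
    change σ (α (k + 1)) ∈ towerField F α i
    rw [h3]
    exact gsgPhi_mem (fun j hj => gsg_alpha_mem F α hj) _
  exact ⟨⟩

lemma gsg_agree {i : ℕ} {σ τ : AlgebraicClosure F ≃ₐ[F] AlgebraicClosure F} {g : G}
    (hσ : gsgRel act F α i σ g) (hτ : gsgRel act F α i τ g) (x : towerField F α i) :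
    σ x = τ x := by
  have : (σ : AlgebraicClosure F →ₐ[F] AlgebraicClosure F).comp (towerField F α i).val =
      (τ : AlgebraicClosure F →ₐ[F] AlgebraicClosure F).comp (towerField F α i).val := by
    apply IntermediateField.algHom_ext_of_eq_adjoin F (S := towerField F α i) (s := towerSet α i) rfl
    rintro x ⟨j, h1, h2, rfl⟩
    obtain ⟨k, rfl⟩ : ∃ k, j = k + 1 := ⟨j - 1, by omega⟩
    have h3 := (hσ (X ⟨k, by omega⟩)).trans (hτ (X ⟨k, by omega⟩)).symm
    have h4 : gsgPhi p F α i (X ⟨k, by omega⟩) = α (k + 1) := by simp [gsgPhi]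
    rw [h4] at h3
    exact h3
  exact congrArg (fun f => f x) this

/-- the graph of the isomorphism -/
def gsgQ (act : (i : ℕ) → G →* RingAut (MvPolynomial (Fin i) (ZMod p))) (Gs : ℕ → Subgroup G)
    {F : Type*} [Field F] [CharP F p] (α : ℕ → AlgebraicClosure F) (i : ℕ)
    (σ : towerField F α i ≃ₐ[F] towerField F α i) (γ : G ⧸ Gs i) : Prop :=
  ∃ (τ : AlgebraicClosure F ≃ₐ[F] AlgebraicClosure F) (g : G),
    (∀ x : towerField F α i, τ x = σ x) ∧ QuotientGroup.mk g = γ ∧ gsgRel act F α i τ g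

lemma gsgQ_unique (hA : GAct p n Gs D act) (h0 : Gs 0 = ⊤) {i : ℕ} (hi : i ≤ n)
    {σ : towerField F α i ≃ₐ[F] towerField F α i} {γ γ' : G ⧸ Gs i}
    (h : gsgQ act Gs α i σ γ) (h' : gsgQ act Gs α i σ γ') : γ = γ' := by
  obtain ⟨τ, g, h1, rfl, h3⟩ := h
  obtain ⟨τ', g', h1', rfl, h3'⟩ := h'
  rw [QuotientGroup.eq]
  apply gsgRel_unique (F := F) α hA hi _ h0
  have key : gsgRel act F α i τ g' := by
    intro q
    rw [← h3' q]
    have hq : gsgPhi p F α i q ∈ towerField F α i :=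
      gsgPhi_mem (fun j hj => gsg_alpha_mem F α hj) q
    exact (h1 ⟨_, hq⟩).trans (h1' ⟨_, hq⟩).symm
  have := gsgRel_mul (gsgRel_inv h3) key
  rwa [inv_mul_cancel] at this

lemma gsgQ_equiv (hA : GAct p n Gs D act) (hG : GFilt p n Gs) (h0 : Gs 0 = ⊤)
    (hα : ∀ i < n, α (i + 1) ^ p - α (i + 1) =
      gsgPhi p F α i (D i) + algebraMap F (AlgebraicClosure F) (a (i + 1)))
    (ha : ∀ c : ℕ → ZMod p, (∀ j, c j ≠ 0 → j < n ∧ splitAt Gs (j + 1)) →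
      (∃ y : F, (∑ j ∈ Finset.range n, ZMod.castHom (dvd_refl p) F (c j) * a (j + 1)) =
        y ^ p - y) → ∀ j, c j = 0) (i : ℕ) (hi : i ≤ n) :
    ∃ e : (towerField F α i ≃ₐ[F] towerField F α i) ≃* (G ⧸ Gs i),
      ∀ σ, gsgQ act Gs α i σ (e σ) := by
  have hgal := gsg_galois hA hG hα i hi
  apply gsg_mulEquiv
  · intro σ
    obtain ⟨τ, hτ⟩ := AlgEquiv.restrictNormalHom_surjective (F := F)
        (K₁ := towerField F α i) (AlgebraicClosure F) σ
    obtain ⟨g, hg⟩ := gsgRel_exists hA hG hα τ i hi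
    refine ⟨QuotientGroup.mk g, τ, g, ?_, rfl, hg⟩
    intro x
    rw [← hτ]
    exact (AlgEquiv.restrictNormal_commutes τ (towerField F α i) x).symm
  · intro σ γ γ' h h'
    exact gsgQ_unique hA h0 hi h h'
  · intro γ
    obtain ⟨g, rfl⟩ := QuotientGroup.mk_surjective γ
    have := gsg_surj hA hG h0 hα _ (gsg_sep hα) gsg_fix ha i hi
    obtain ⟨τ, hτ⟩ : g ∈ gsgIm act F α i := by rw [this]; trivial
    refine ⟨AlgEquiv.restrictNormalHom (towerField F α i) τ, τ, g, ?_, rfl, hτ⟩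
    intro x
    exact (AlgEquiv.restrictNormal_commutes τ (towerField F α i) x).symm
  · rintro σ σ' γ ⟨τ, g, h1, rfl, h3⟩ ⟨τ', g', h1', h2', h3'⟩
    rw [QuotientGroup.eq] at h2'
    have h4 := gsgRel_mem hA hi h2' h3'
    rw [mul_inv_cancel_left] at h4
    ext x
    rw [← h1, ← h1']
    exact gsg_agree h3 h4 x
  · rintro σ σ' γ γ' ⟨τ, g, h1, rfl, h3⟩ ⟨τ', g', h1', rfl, h3'⟩
    refine ⟨τ * τ', g * g', ?_, rfl, gsgRel_mul h3 h3'⟩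
    intro x
    rw [AlgEquiv.mul_apply, AlgEquiv.mul_apply, h1', h1]

lemma gsgQ_compat (hA : GAct p n Gs D act) (hG : GFilt p n Gs) {i : ℕ} (hi : i < n)
    {σ : towerField F α (i + 1) ≃ₐ[F] towerField F α (i + 1)}
    {τ : towerField F α i ≃ₐ[F] towerField F α i}
    (h : ∀ x : towerField F α i, (σ ⟨(x : AlgebraicClosure F),
      towerField_mono F α (Nat.le_succ i) x.2⟩ : AlgebraicClosure F) = τ x)
    (g : G) (hQ : gsgQ act Gs α (i + 1) σ (QuotientGroup.mk g)) :
    gsgQ act Gs α i τ (QuotientGroup.mk g) := by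
  obtain ⟨ρ, g', h1, h2, h3⟩ := hQ
  refine ⟨ρ, g', fun x => ?_, ?_, gsgRel_down hA hi h3⟩
  · rw [← h x, ← h1]
  · rw [QuotientGroup.eq] at h2 ⊢
    exact (hG.anti i hi).le h2

end

lemma gsg_act {p n : ℕ} {G : Type*} [Group G] {Gser : ℕ → Subgroup G} [∀ j, (Gser j).Normal]
    (htop : Gser 0 = ⊤)
    {D : (j : ℕ) → MvPolynomial (Fin (j - 1)) (ZMod p)}
    (hD : IsSaltmanFamily p n G Gser D) :
    ∃ act, GAct p n Gser (fun i => D (i + 1)) act := by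
  obtain ⟨h1, ρ, hρ⟩ := hD
  refine ⟨fun i => (ρ i).comp (QuotientGroup.mk' (Gser i)), ?_, ?_, ?_, ?_⟩
  · intro i hi g
    change ρ i (QuotientGroup.mk g) = 1 ↔ _
    rcases Nat.eq_zero_or_pos i with rfl | hpos
    · have : g ∈ Gser 0 := by rw [htop]; trivial
      rw [(QuotientGroup.eq_one_iff g).2 this]
      simpa using this
    · rw [← map_one (ρ i), (hρ i hpos hi).1.eq_iff, QuotientGroup.eq_one_iff]
  · intro i hi g q
    exact (hρ (i + 1) (by omega) hi).2.2.2 g q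
  · intro i hi g
    refine ((hρ (i + 1) (by omega) hi).2.1 (Xelt p D (i + 1) (i + 1) (by omega))).2 ?_ _
    exact Algebra.subset_adjoin ⟨i + 1, by omega, le_rfl, rfl⟩
  · intro i hi hs
    exact (h1 (i + 1) (by omega) hi).1 hs

theorem generic_specialization_galois (p n : ℕ) (hp : p.Prime)
    (G : Type*) [Group G] [Finite G] (hG : Nat.card G = p ^ n)
    (Gser : ℕ → Subgroup G) [∀ j, (Gser j).Normal]
    (htop : Gser 0 = ⊤) (hbot : Gser n = ⊥)
    (hlt : ∀ j, j < n → Gser (j + 1) < Gser j)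
    (hcard : ∀ j, j ≤ n → Nat.card (Gser j) = p ^ (n - j))
    (D : (j : ℕ) → MvPolynomial (Fin (j - 1)) (ZMod p))
    (hD : IsSaltmanFamily p n G Gser D)
    (F : Type*) [Field F] [CharP F p]
    -- dim_{F_p} F/℘(F) ≥ r = rank(G):
    (hdim : ∃ t : Fin (pRank G) → F,
      ∀ c : Fin (pRank G) → ZMod p,
        (∃ y : F, (∑ i, ZMod.castHom (dvd_refl p) F (c i) * t i) = y ^ p - y) →
        ∀ i, c i = 0)
    (a : ℕ → F)
    -- {a_j + ℘(F) : j ∈ Σ_G} is F_p-linearly independent in F/℘(F):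
    (ha : ∀ c : ℕ → ZMod p,
      (∀ j, c j ≠ 0 → 1 ≤ j ∧ j ≤ n ∧ splitAt Gser j) →
      (∃ y : F, (∑ j ∈ Finset.Icc 1 n, ZMod.castHom (dvd_refl p) F (c j) * a j) =
        y ^ p - y) →
      ∀ j, c j = 0)
    (α : ℕ → AlgebraicClosure F)
    -- α_i^p − α_i = d_i + a_i where d_i = D_i(α_1,...,α_{i-1}):
    (hα : ∀ i, 1 ≤ i → i ≤ n →
      α i ^ p - α i =
        eval₂ ((algebraMap F (AlgebraicClosure F)).comp (ZMod.castHom (dvd_refl p) F))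
          (fun k : Fin (i - 1) => α ((k : ℕ) + 1)) (D i) +
        algebraMap F (AlgebraicClosure F) (a i)) :
    ∃ μ : (i : ℕ) → i ≤ n →
        ((↥(towerField F α i) ≃ₐ[F] ↥(towerField F α i)) ≃* (G ⧸ Gser i)),
      ∀ i, (hin : i ≤ n) →
        IsGalois F ↥(towerField F α i) ∧
        (1 ≤ i →
          -- compatibility: if σ ∈ Gal(F_i/F) restricts to τ ∈ Gal(F_{i-1}/F), then
          -- μ_{i-1}(τ) is the image of μ_i(σ) under G/G_(i) → G/G_(i-1)
          ∀ (σ : ↥(towerField F α i) ≃ₐ[F] ↥(towerField F α i))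
            (τ : ↥(towerField F α (i - 1)) ≃ₐ[F] ↥(towerField F α (i - 1))),
            (∀ x : ↥(towerField F α (i - 1)),
              (↑(σ ⟨(x : AlgebraicClosure F),
                    towerField_mono F α (Nat.sub_le i 1) x.2⟩) : AlgebraicClosure F) =
                ↑(τ x)) →
            ∀ g : G, μ i hin σ = QuotientGroup.mk g →
              μ (i - 1) (le_trans (Nat.sub_le i 1) hin) τ = QuotientGroup.mk g) := by
  have : Fact p.Prime := ⟨hp⟩
  obtain ⟨act, hA⟩ := gsg_act htop hD
  have hFil : GFilt p n Gser := ⟨hlt, hcard⟩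
  have hα' : ∀ i < n, α (i + 1) ^ p - α (i + 1) =
      gsgPhi p F α i (D (i + 1)) + algebraMap F (AlgebraicClosure F) (a (i + 1)) := by
    intro i hi
    exact hα (i + 1) (by omega) hi
  have ha' : ∀ c : ℕ → ZMod p, (∀ j, c j ≠ 0 → j < n ∧ splitAt Gser (j + 1)) →
      (∃ y : F, (∑ j ∈ Finset.range n, ZMod.castHom (dvd_refl p) F (c j) * a (j + 1)) =
        y ^ p - y) → ∀ j, c j = 0 := by
    intro c hc ⟨y, hy⟩ j
    have := ha (fun j => if j = 0 then 0 else c (j - 1)) (by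
      intro j hj
      rcases j with _ | j
      · simp at hj
      · have := hc j (by simpa using hj)
        exact ⟨by omega, this.1, this.2⟩) ⟨y, by
        rw [← hy, Finset.range_eq_Ico]
        refine Eq.trans ?_ (Finset.sum_Ico_add' (fun j =>
          ZMod.castHom (dvd_refl p) F (c (j - 1)) * a j) 0 n 1).symm
        apply Finset.sum_congr
        · ext j
          simp only [Finset.mem_Icc, Finset.mem_Ico]
          omega
        · intro j hj
          have := (Finset.mem_Ico.1 hj).1
          rw [if_neg (by omega)]⟩ (j + 1)
    simpa using this
  choose μ hμ using gsgQ_equiv hA hFil htop hα' ha'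
  refine ⟨μ, fun i hin => ⟨gsg_galois hA hFil hα' i hin, ?_⟩⟩
  intro h1 σ τ hστ g hg
  obtain ⟨k, rfl⟩ : ∃ k, i = k + 1 := ⟨i - 1, by omega⟩
  have hk : k < n := hin
  have hQ := hμ (k + 1) hin σ
  rw [hg] at hQ
  exact gsgQ_unique hA htop hk.le (hμ k hk.le τ) (gsgQ_compat hA hFil hk hστ g hQ)
end

section
/- Let (G, {G_(i)}) be a p-filtered group of order p^n with r = rank(G), and let D_i ∈ F_p[Y_1,...,Y_{i-1}] (1 ≤ i ≤ n) be polynomials satisfying the conditions of the generic construction. Let F be a field of characteristic p with dim_{F_p}(F/℘(F)) ≥ r. Let F = F_0 ⊂ F_1 ⊂ ... ⊂ F_n be a tower of Galois field extensions of F such that there is an isomorphism μ : Gal(F_n/F) → G with μ(Gal(F_n/F_i)) = G_(i) for 0 ≤ i ≤ n. Then there exist a_1,...,a_n ∈ F such that F_i = F(α_1,...,α_i) for 0 ≤ i ≤ n, where the α_j ∈ F^sep are defined recursively by α_j^p − α_j = d_j + a_j with d_j = D_j(α_1,...,α_{j-1}). -/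
/-!
STATEMENT 9 (Theorem 3.6(b) of the paper):
Let (G, {G_(i)}) be a p-filtered group of order p^n with r = rank(G), and let D_i be
polynomials satisfying the conditions of the generic construction.  Let F be a field of
characteristic p with dim_{F_p}(F/℘(F)) ≥ r, and let F = F_0 ⊂ F_1 ⊂ ... ⊂ F_n be a
tower of Galois extensions of F with an isomorphism μ : Gal(F_n/F) ≅ G satisfying
μ(Gal(F_n/F_i)) = G_(i).  Then there are a_1,...,a_n ∈ F such that
F_i = F(α_1,...,α_i), where α_j^p − α_j = d_j + a_j and d_j = D_j(α_1,...,α_{j-1}).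
-/

open MvPolynomial

lemma aux_hilbert90 {F L : Type*} [Field F] [Field L] [Algebra F L] [IsGalois F L]
    [FiniteDimensional F L] (c : (L ≃ₐ[F] L) → L)
    (hc : ∀ g h, c (g * h) = g (c h) + c g) : ∃ x : L, ∀ g, g x = x + c g := by
  classical
  obtain ⟨z, hz⟩ := Algebra.trace_surjective F L 1
  have hz' : ∑ σ : L ≃ₐ[F] L, σ z = 1 := by
    rw [← trace_eq_sum_automorphisms, hz, map_one]
  refine ⟨-∑ h : L ≃ₐ[F] L, c h * h z, fun g => ?_⟩
  have h1 : g (∑ h : L ≃ₐ[F] L, c h * h z) = ∑ h : L ≃ₐ[F] L, (c (g * h) - c g) * (g * h) z := by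
    rw [map_sum]
    refine Finset.sum_congr rfl fun h _ => ?_
    rw [hc, map_mul, AlgEquiv.mul_apply]; ring
  have h2 : ∑ h : L ≃ₐ[F] L, (c (g * h) - c g) * (g * h) z
      = ∑ h : L ≃ₐ[F] L, (c h - c g) * h z :=
    Fintype.sum_equiv (Equiv.mulLeft g) _ _ (fun h => rfl)
  rw [map_neg, h1, h2]
  simp only [sub_mul, Finset.sum_sub_distrib, ← Finset.mul_sum, hz']
  ring

lemma aux_descend (p : ℕ) [Fact p.Prime] (j : ℕ) (c : MvPolynomial (Fin (j + 1)) (ZMod p))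
    (d : MvPolynomial (Fin j) (ZMod p)) (h : j ≤ j + 1)
    (hc : c ^ p - c = rename (Fin.castLE h) d) : ∃ e, c = rename (Fin.castLE h) e := by
  classical
  have hd : degreeOf (Fin.last j) (rename (Fin.castLE h) d) = 0 := by
    by_contra hm
    rw [← ne_eq, ← mem_vars_iff_degreeOf_ne_zero] at hm
    have := vars_rename _ _ hm
    simp only [Finset.mem_image] at this
    obtain ⟨a, -, ha⟩ := this
    have := congrArg Fin.val ha
    simp at this
    have := a.2
    omega
  have h1 : c ^ p = c + rename (Fin.castLE h) d := by rw [← hc]; ring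
  have h2 := degreeOf_add_le (Fin.last j) c (rename (Fin.castLE h) d)
  have h3 : degreeOf (Fin.last j) (c ^ p) = p * degreeOf (Fin.last j) c := by
    by_cases h0 : c = 0
    · subst h0; rw [zero_pow (Fact.out : p.Prime).ne_zero]; simp
    · exact degreeOf_pow_eq _ _ _ h0
  rw [← h1, h3, hd] at h2
  have h4 : degreeOf (Fin.last j) c = 0 := by
    have := (Fact.out : p.Prime).two_le
    simp only [Nat.max_zero] at h2
    nlinarith
  replace h4 : Fin.last j ∉ c.vars := fun hh => mem_vars_iff_degreeOf_ne_zero.1 hh h4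
  obtain ⟨e, he⟩ := exists_rename_eq_of_vars_subset_range c (Fin.castLE h)
    (Fin.castLE_injective h) (by
      intro x hx
      have hne : x ≠ Fin.last j := by rintro rfl; exact h4 hx
      have : x.1 < j := by
        have := x.2
        have : x.1 ≠ j := fun hh => hne (Fin.ext hh)
        omega
      exact ⟨⟨x.1, this⟩, rfl⟩)
  exact ⟨e, he.symm⟩

lemma aux_cocycle (p : ℕ) [Fact p.Prime] (j : ℕ)
    (σ : RingAut (MvPolynomial (Fin (j + 1)) (ZMod p)))
    (τ : RingAut (MvPolynomial (Fin j) (ZMod p))) (D : MvPolynomial (Fin j) (ZMod p))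
    (h : j ≤ j + 1)
    (hcomp : ∀ q, σ (rename (Fin.castLE h) q) = rename (Fin.castLE h) (τ q))
    (hX : σ (X (Fin.last j) ^ p - X (Fin.last j) - rename (Fin.castLE h) D) =
      X (Fin.last j) ^ p - X (Fin.last j) - rename (Fin.castLE h) D) :
    ∃ c, σ (X (Fin.last j)) = X (Fin.last j) + rename (Fin.castLE h) c := by
  obtain ⟨e, he⟩ := aux_descend p j (σ (X (Fin.last j)) - X (Fin.last j)) (τ D - D) h (by
    rw [sub_pow_char, map_sub (rename (R := ZMod p) (Fin.castLE h)), ← hcomp]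
    rw [map_sub, map_sub, map_pow] at hX
    linear_combination hX)
  exact ⟨e, by rw [← he]; ring⟩

/-- equivariance of the evaluation at `α 1, ..., α j` -/
def AuxEquiv {p : ℕ} {L Γ : Type*} [Field L] (f : ZMod p →+* L) (α : ℕ → L) (j : ℕ)
    (r : Γ → RingAut (MvPolynomial (Fin j) (ZMod p))) (s : Γ → L →+* L) : Prop :=
  ∀ g q, eval₂ f (fun k : Fin j => α ((k : ℕ) + 1)) (r g q) =
    s g (eval₂ f (fun k : Fin j => α ((k : ℕ) + 1)) q)

lemma aux_equiv_of_X {p : ℕ} {L Γ : Type*} [Field L] (f : ZMod p →+* L) (α : ℕ → L) (j : ℕ)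
    (r : Γ → RingAut (MvPolynomial (Fin j) (ZMod p))) (s : Γ → L →+* L)
    (h : ∀ g (k : Fin j), eval₂ f (fun k : Fin j => α ((k : ℕ) + 1)) (r g (X k)) =
      s g (α (k + 1))) : AuxEquiv f α j r s := by
  intro g q
  have : (eval₂Hom f (fun k : Fin j => α ((k : ℕ) + 1))).comp
        (r g : MvPolynomial (Fin j) (ZMod p) →+* _) =
      (s g).comp (eval₂Hom f (fun k : Fin j => α ((k : ℕ) + 1))) := by
    apply MvPolynomial.ringHom_ext'
    · exact RingHom.ext_zmod _ _
    · intro k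
      simpa using h g k
  exact RingHom.congr_fun this q

lemma aux_step {p : ℕ} [Fact p.Prime] {G F L : Type*} [Group G] [Field F] [Field L] [Algebra F L]
    [IsGalois F L] [FiniteDimensional F L] (μ : (L ≃ₐ[F] L) ≃* G) (f : ZMod p →+* L)
    (α : ℕ → L) (j : ℕ)
    (σ : G →* RingAut (MvPolynomial (Fin (j + 1)) (ZMod p)))
    (τ : G →* RingAut (MvPolynomial (Fin j) (ZMod p))) (D : MvPolynomial (Fin j) (ZMod p))
    (h : j ≤ j + 1)
    (hcomp : ∀ g q, σ g (rename (Fin.castLE h) q) = rename (Fin.castLE h) (τ g q))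
    (hX : ∀ g, σ g (X (Fin.last j) ^ p - X (Fin.last j) - rename (Fin.castLE h) D) =
      X (Fin.last j) ^ p - X (Fin.last j) - rename (Fin.castLE h) D)
    (hα : AuxEquiv f α j τ (fun g => ((μ.symm g : L ≃ₐ[F] L) : L →+* L))) :
    ∃ x, AuxEquiv f (Function.update α (j + 1) x) (j + 1) σ
      (fun g => ((μ.symm g : L ≃ₐ[F] L) : L →+* L)) := by
  choose c hc using fun g => aux_cocycle p j (σ g) (τ g) D h (hcomp g) (hX g)
  have hcc : ∀ g k, c (g * k) = τ g (c k) + c g := by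
    intro g k
    apply rename_injective _ (Fin.castLE_injective h)
    have h1 := hc (g * k)
    rw [map_mul, RingAut.mul_apply, hc, map_add, hc, hcomp] at h1
    rw [map_add]
    linear_combination -h1
  set φ := fun q => eval₂ f (fun k : Fin j => α ((k : ℕ) + 1)) q with hφ
  obtain ⟨x, hx⟩ := aux_hilbert90 (fun g : L ≃ₐ[F] L => φ (c (μ g))) (by
    intro g k
    simp only [hφ, map_mul, hcc, eval₂_add]
    rw [hα]
    simp)
  have hres : ∀ q, eval₂ f (fun k : Fin (j + 1) => Function.update α (j + 1) x ((k : ℕ) + 1))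
      (rename (Fin.castLE h) q) = φ q := by
    intro q
    rw [eval₂_rename]
    simp only [hφ]
    congr 1
    funext k
    have := k.2
    simp [Function.update_apply]
    omega
  refine ⟨x, aux_equiv_of_X _ _ _ _ _ fun g k => ?_⟩
  by_cases hk : k.1 = j
  · obtain rfl : k = Fin.last j := Fin.ext hk
    rw [hc, eval₂_add, hres]
    have := hx (μ.symm g)
    simp at this
    simp [this]
  · have hk' : k.1 < j := by have := k.2; omega
    have : (X k : MvPolynomial (Fin (j + 1)) (ZMod p))
        = rename (Fin.castLE h) (X (⟨k.1, hk'⟩ : Fin j)) := by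
      rw [rename_X]; rfl
    rw [this, hcomp, hres]
    have := hα g (X (⟨k.1, hk'⟩ : Fin j))
    simp only [hφ]
    rw [this]
    simp [Function.update_apply, hk]

theorem generic_specialization_converse (p n : ℕ) (hp : p.Prime)
    (G : Type*) [Group G] [Finite G] (hG : Nat.card G = p ^ n)
    (Gser : ℕ → Subgroup G) [∀ j, (Gser j).Normal]
    (htop : Gser 0 = ⊤) (hbot : Gser n = ⊥)
    (hlt : ∀ j, j < n → Gser (j + 1) < Gser j)
    (hcard : ∀ j, j ≤ n → Nat.card (Gser j) = p ^ (n - j))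
    (D : (j : ℕ) → MvPolynomial (Fin (j - 1)) (ZMod p))
    (hD : IsSaltmanFamily p n G Gser D)
    (F : Type*) [Field F] [CharP F p]
    (hdim : ∃ t : Fin (pRank G) → F,
      ∀ c : Fin (pRank G) → ZMod p,
        (∃ y : F, (∑ i, ZMod.castHom (dvd_refl p) F (c i) * t i) = y ^ p - y) →
        ∀ i, c i = 0)
    -- the tower F = F_0 ⊂ F_1 ⊂ ... ⊂ F_n, realized inside L = F_n:
    (L : Type*) [Field L] [Algebra F L] [IsGalois F L] [FiniteDimensional F L]
    (Fi : ℕ → IntermediateField F L)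
    (hF0 : Fi 0 = ⊥) (hFn : Fi n = ⊤)
    (hFmono : ∀ i, i < n → Fi i ≤ Fi (i + 1))
    (hFgalois : ∀ i, i ≤ n → IsGalois F ↥(Fi i))
    -- μ : Gal(F_n/F) ≅ G with μ(Gal(F_n/F_i)) = G_(i):
    (μ : (L ≃ₐ[F] L) ≃* G)
    (hμ : ∀ i, i ≤ n →
      Subgroup.map μ.toMonoidHom (Fi i).fixingSubgroup = Gser i) :
    ∃ (a : ℕ → F) (α : ℕ → L),
      (∀ i, 1 ≤ i → i ≤ n →
        α i ^ p - α i =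
          eval₂ ((algebraMap F L).comp (ZMod.castHom (dvd_refl p) F))
            (fun k : Fin (i - 1) => α ((k : ℕ) + 1)) (D i) +
          algebraMap F L (a i)) ∧
      (∀ i, i ≤ n →
        Fi i = IntermediateField.adjoin F {x : L | ∃ j, 1 ≤ j ∧ j ≤ i ∧ x = α j}) := by
  have : Fact p.Prime := ⟨hp⟩
  obtain ⟨hD1, ρ, hρ⟩ := hD
  set f : ZMod p →+* L := (algebraMap F L).comp (ZMod.castHom (dvd_refl p) F) with hf
  let r : (i : ℕ) → G →* RingAut (MvPolynomial (Fin i) (ZMod p)) :=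
    fun i => (ρ i).comp (QuotientGroup.mk' (Gser i))
  let s : G → L →+* L := fun g => ((μ.symm g : L ≃ₐ[F] L) : L →+* L)
  have hinv : ∀ j, j + 1 ≤ n → ∀ g, r (j + 1) g (Xelt p D (j + 1) (j + 1) (by omega)) =
      Xelt p D (j + 1) (j + 1) (by omega) := by
    intro j hj g
    obtain ⟨-, h2, -, -⟩ := hρ (j + 1) (by omega) hj
    exact (h2 _).2 (Algebra.subset_adjoin ⟨j + 1, by omega, le_rfl, rfl⟩) _
  have key : ∀ i, i ≤ n → ∃ α : ℕ → L, ∀ j, j ≤ i → AuxEquiv f α j (r j) s := by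
    intro i
    induction i with
    | zero =>
      intro _
      refine ⟨fun _ => 0, fun j hj => ?_⟩
      obtain rfl : j = 0 := by omega
      exact aux_equiv_of_X _ _ _ _ _ fun g k => k.elim0
    | succ j ih =>
      intro hj
      obtain ⟨α, hα⟩ := ih (by omega)
      obtain ⟨-, -, -, h4⟩ := hρ (j + 1) (by omega) hj
      obtain ⟨x, hx⟩ := aux_step μ f α j (r (j + 1)) (r j) (D (j + 1)) (Nat.le_succ j)
        (fun g q => h4 g q) (fun g => hinv j hj g) (hα j le_rfl)
      refine ⟨Function.update α (j + 1) x, fun k hk => ?_⟩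
      rcases Nat.lt_or_ge j k with hk' | hk'
      · obtain rfl : k = j + 1 := by omega
        exact hx
      · have := hα k hk'
        intro g q
        have e : (fun m : Fin k => Function.update α (j + 1) x ((m : ℕ) + 1)) =
            fun m : Fin k => α ((m : ℕ) + 1) := by
          funext m
          have := m.2
          rw [Function.update_of_ne (by omega)]
        rw [e]
        exact this g q
  obtain ⟨α, hα⟩ := key n le_rfl
  have ha : ∀ i, ∃ a : F, 1 ≤ i → i ≤ n → α i ^ p - α i =
          eval₂ f (fun k : Fin (i - 1) => α ((k : ℕ) + 1)) (D i) + algebraMap F L a := by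
    intro i
    by_cases hi : 1 ≤ i ∧ i ≤ n
    swap
    · exact ⟨0, fun h1 h2 => absurd ⟨h1, h2⟩ hi⟩
    obtain ⟨h1, h2⟩ := hi
    obtain ⟨j, rfl⟩ : ∃ j, i = j + 1 := ⟨i - 1, by omega⟩
    have hval : eval₂ f (fun k : Fin (j + 1) => α ((k : ℕ) + 1))
        (Xelt p D (j + 1) (j + 1) (by omega)) = α (j + 1) ^ p - α (j + 1) -
          eval₂ f (fun k : Fin (j + 1 - 1) => α ((k : ℕ) + 1)) (D (j + 1)) := by
      unfold Xelt
      rw [eval₂_sub, eval₂_sub, eval₂_pow, eval₂_X, eval₂_rename]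
      rfl
    have hfix : ∀ g : L ≃ₐ[F] L, g (eval₂ f (fun k : Fin (j + 1) => α ((k : ℕ) + 1))
        (Xelt p D (j + 1) (j + 1) (by omega))) = eval₂ f (fun k : Fin (j + 1) => α ((k : ℕ) + 1))
        (Xelt p D (j + 1) (j + 1) (by omega)) := by
      intro g
      have := hα (j + 1) h2 (μ g) (Xelt p D (j + 1) (j + 1) (by omega))
      rw [hinv j h2] at this
      simpa [s] using this.symm
    obtain ⟨a, ha⟩ := (IsGalois.mem_range_algebraMap_iff_fixed _).2 hfix
    refine ⟨a, fun _ _ => ?_⟩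
    rw [ha, hval]; ring
  choose a ha using ha
  refine ⟨a, α, ha, fun i hi => ?_⟩
  apply IsGalois.intermediateFieldEquivSubgroup.injective
  apply OrderDual.toDual.injective
  show (Fi i).fixingSubgroup = (IntermediateField.adjoin F _).fixingSubgroup
  have hmem : ∀ g, g ∈ (Fi i).fixingSubgroup ↔ μ g ∈ Gser i := by
    intro g
    rw [← hμ i hi]
    exact (Subgroup.mem_map_iff_mem μ.injective).symm
  ext g
  rw [hmem, IntermediateField.mem_fixingSubgroup_iff]
  have hs : ∀ x, s (μ g) x = g x := fun x => by simp [s]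
  constructor
  · intro hg x hx
    have hle : IntermediateField.adjoin F {x : L | ∃ j, 1 ≤ j ∧ j ≤ i ∧ x = α j} ≤
        IntermediateField.fixedField (Subgroup.zpowers g) := by
      rw [IntermediateField.adjoin_le_iff]
      rintro _ ⟨j, h1, h2, rfl⟩
      have hgj : g (α j) = α j := by
        obtain ⟨m, rfl⟩ : ∃ m, j = m + 1 := ⟨j - 1, by omega⟩
        have := hα i hi (μ g) (X ⟨m, by omega⟩)
        have h1 : r i (μ g) = 1 := by
          have : (QuotientGroup.mk' (Gser i)) (μ g) = 1 := (QuotientGroup.eq_one_iff _).2 hg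
          simp only [r, MonoidHom.comp_apply, this, map_one]
        rw [h1, hs] at this
        simpa using this.symm
      rintro ⟨k, hk⟩
      have : Subgroup.zpowers g ≤ MulAction.stabilizer (L ≃ₐ[F] L) (α j) := by
        rw [Subgroup.zpowers_le]; exact hgj
      exact this hk
    exact hle hx ⟨g, Subgroup.mem_zpowers g⟩
  · intro hg
    rcases Nat.eq_zero_or_pos i with rfl | hpos
    · rw [htop]; trivial
    by_contra hne
    obtain ⟨-, -, h3, -⟩ := hρ i hpos hi
    let φ := eval₂Hom f (fun k : Fin i => α ((k : ℕ) + 1))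
    obtain ⟨M, hM, hle⟩ := Ideal.exists_le_maximal (RingHom.ker φ) (RingHom.ker_ne_top φ)
    obtain ⟨q, hq⟩ := h3 M hM (QuotientGroup.mk (μ g))
      (fun h => hne ((QuotientGroup.eq_one_iff _).1 h))
    apply hq
    apply hle
    rw [RingHom.mem_ker, map_sub, sub_eq_zero]
    have := hα i hi (μ g) q
    rw [hs] at this
    refine this.trans (hg _ ?_)
    have hgen : ∀ q : MvPolynomial (Fin i) (ZMod p),
        eval₂ f (fun k : Fin i => α ((k : ℕ) + 1)) q ∈
          IntermediateField.adjoin F {x : L | ∃ j, 1 ≤ j ∧ j ≤ i ∧ x = α j} := by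
      intro q
      induction q using MvPolynomial.induction_on with
      | C a =>
        rw [eval₂_C]
        exact IntermediateField.algebraMap_mem _ _
      | add a b h1 h2 =>
        rw [eval₂_add]
        exact add_mem h1 h2
      | mul_X a k h1 =>
        rw [eval₂_mul, eval₂_X]
        exact mul_mem h1 (IntermediateField.subset_adjoin _ _
          ⟨k + 1, by omega, by have := k.2; omega, rfl⟩)
    exact hgen q
end
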